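/- arXiv:1005.4987 — 2 statements merged into one kernel-verified Lean document; each statement's English description precedes it below -/
import Mathlib

section
/- Let (X,w) be a Euclidean 6-design in ℝ^22 supported by exactly two concentric spheres of positive radii r1, r2 centered at the origin, with fibers X1 and X2, |X| = 2300 and |X1| = 275. Then for every y ∈ X2, the number of x ∈ X1 with x·y = r1r2/√11 equals 77, the number with x·y = −r1r2/(4√11) equals 176, and the number with x·y = −3r1r2/(2√11) equals 22. -/
open MeasureTheory Metric MvPolynomial
open scoped RealInnerProductSpace Classical

/-- Average of a polynomial over the sphere of radius `r` centered at the origin in `ℝⁿ`,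
with respect to the (rotation-invariant, normalized) surface measure. -/
noncomputable def sphereAvg (n : ℕ) (r : ℝ) (f : MvPolynomial (Fin n) ℝ) : ℝ :=
  ⨍ u : sphere (0 : EuclideanSpace ℝ (Fin n)) 1,
    eval (fun i => r * (u : EuclideanSpace ℝ (Fin n)) i) f
    ∂((volume : Measure (EuclideanSpace ℝ (Fin n))).toSphere)

/-- `(X₁ ∪ X₂, w)` is a Euclidean `t`-design of `ℝ²²` supported by the two concentric spheres
of radii `r₁` and `r₂` centered at the origin, with fibers `X₁ ⊆ S(0,r₁)` and `X₂ ⊆ S(0,r₂)`. -/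
def IsEuclideanDesignTwoSpheres (t : ℕ) (X₁ X₂ : Finset (EuclideanSpace ℝ (Fin 22)))
    (w : EuclideanSpace ℝ (Fin 22) → ℝ) (r₁ r₂ : ℝ) : Prop :=
  ∀ f : MvPolynomial (Fin 22) ℝ, f.totalDegree ≤ t →
    (∑ x ∈ X₁, w x) * sphereAvg 22 r₁ f + (∑ x ∈ X₂, w x) * sphereAvg 22 r₂ f
      = ∑ x ∈ X₁ ∪ X₂, w x * eval (x : Fin 22 → ℝ) f

section SphereMoments

variable {n : ℕ}

/-- The normalized surface measure on the unit sphere of `ℝⁿ`. -/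
noncomputable def normalizedSphereMeasure (n : ℕ) :
    Measure (sphere (0 : EuclideanSpace ℝ (Fin n)) 1) :=
  ((volume : Measure (EuclideanSpace ℝ (Fin n))).toSphere Set.univ)⁻¹ •
    (volume : Measure (EuclideanSpace ℝ (Fin n))).toSphere

instance [NeZero n] : IsProbabilityMeasure (normalizedSphereMeasure n) := by
  have : NeZero (volume : Measure (EuclideanSpace ℝ (Fin n))).toSphere :=
    ⟨Measure.toSphere_ne_zero _⟩
  unfold normalizedSphereMeasure
  infer_instance

/-- The action of a linear isometry on the unit sphere. -/
noncomputable def sphereIsometry (g : EuclideanSpace ℝ (Fin n) ≃ₗᵢ[ℝ] EuclideanSpace ℝ (Fin n))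
    (u : sphere (0 : EuclideanSpace ℝ (Fin n)) 1) : sphere (0 : EuclideanSpace ℝ (Fin n)) 1 :=
  ⟨g u, by simp⟩

theorem continuous_sphereIsometry
    (g : EuclideanSpace ℝ (Fin n) ≃ₗᵢ[ℝ] EuclideanSpace ℝ (Fin n)) :
    Continuous (sphereIsometry g) :=
  (g.continuous.comp continuous_subtype_val).subtype_mk _

open scoped Pointwise in
theorem measurePreserving_sphereIsometry
    (g : EuclideanSpace ℝ (Fin n) ≃ₗᵢ[ℝ] EuclideanSpace ℝ (Fin n)) :
    MeasurePreserving (sphereIsometry g) (normalizedSphereMeasure n)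
      (normalizedSphereMeasure n) := by
  refine MeasurePreserving.smul_measure ⟨(continuous_sphereIsometry g).measurable, ?_⟩ _
  ext s hs
  rw [Measure.map_apply (continuous_sphereIsometry g).measurable hs,
    Measure.toSphere_apply' _ hs,
    Measure.toSphere_apply' _ ((continuous_sphereIsometry g).measurable hs)]
  congr 1
  rw [← g.measurePreserving.measure_preimage_equiv (f := g.toMeasurableEquiv)
    (Set.Ioo (0 : ℝ) 1 • ((↑) '' s : Set (EuclideanSpace ℝ (Fin n))))]
  congr 1
  ext x
  simp only [Set.mem_smul, Set.mem_image, Set.mem_preimage]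
  constructor
  · rintro ⟨r, hr, _, ⟨u, hu, rfl⟩, rfl⟩
    exact ⟨r, hr, _, ⟨_, hu, rfl⟩, (g.map_smul r u).symm⟩
  · rintro ⟨r, hr, _, ⟨u, hu, rfl⟩, h⟩
    refine ⟨r, hr, _, ⟨sphereIsometry g.symm u, ?_, rfl⟩, ?_⟩
    · convert hu
      ext1
      simp [sphereIsometry]
    · apply g.injective
      change r • (u : EuclideanSpace ℝ (Fin n)) = g x at h
      rw [map_smul, ← h]
      simp [sphereIsometry]

theorem integrable_normalizedSphereMeasure [NeZero n]
    {f : sphere (0 : EuclideanSpace ℝ (Fin n)) 1 → ℝ} (hf : Continuous f) :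
    Integrable f (normalizedSphereMeasure n) :=
  hf.integrable_of_hasCompactSupport (HasCompactSupport.of_compactSpace f)

/-- The `k`-th moment of the unit sphere in the direction `v`. -/
noncomputable def sphereMoment (k : ℕ) (v : EuclideanSpace ℝ (Fin n)) : ℝ :=
  ∫ u : sphere (0 : EuclideanSpace ℝ (Fin n)) 1,
    ⟪(u : EuclideanSpace ℝ (Fin n)), v⟫ ^ k ∂(normalizedSphereMeasure n)

theorem sphereMoment_isometry (k : ℕ)
    (g : EuclideanSpace ℝ (Fin n) ≃ₗᵢ[ℝ] EuclideanSpace ℝ (Fin n))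
    (v : EuclideanSpace ℝ (Fin n)) : sphereMoment k (g v) = sphereMoment k v := by
  have h := (measurePreserving_sphereIsometry g.symm).integral_comp
    ((continuous_sphereIsometry g.symm).measurableEmbedding
      (fun a b h => by
        ext1
        exact g.symm.injective (congrArg Subtype.val h)))
    (fun u => ⟪(u : EuclideanSpace ℝ (Fin n)), v⟫ ^ k)
  unfold sphereMoment
  rw [← h]
  refine integral_congr_ae (Filter.Eventually.of_forall fun u => ?_)
  have := g.symm.inner_map_map (u : EuclideanSpace ℝ (Fin n)) (g v)
  simp only [LinearIsometryEquiv.symm_apply_apply] at this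
  simp only [sphereIsometry, this]

theorem sphereMoment_eq_of_norm_eq (k : ℕ) {v w : EuclideanSpace ℝ (Fin n)} (h : ‖v‖ = ‖w‖) :
    sphereMoment k v = sphereMoment k w := by
  rw [← Submodule.reflection_sub h, sphereMoment_isometry]

theorem sphereMoment_smul (k : ℕ) (a : ℝ) (v : EuclideanSpace ℝ (Fin n)) :
    sphereMoment k (a • v) = a ^ k * sphereMoment k v := by
  simp only [sphereMoment, inner_smul_right, mul_pow, integral_const_mul]

theorem sphereMoment_of_odd {k : ℕ} (hk : Odd k) (v : EuclideanSpace ℝ (Fin n)) :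
    sphereMoment k v = 0 := by
  have h := sphereMoment_smul k (-1) v
  rw [hk.neg_one_pow, sphereMoment_eq_of_norm_eq k (w := v) (by simp)] at h
  linarith

theorem sphereMoment_zero [NeZero n] (v : EuclideanSpace ℝ (Fin n)) : sphereMoment 0 v = 1 := by
  simp [sphereMoment]

/-- The `k`-th moment of the first coordinate on the unit sphere. -/
noncomputable def coordMoment (n : ℕ) [NeZero n] (k : ℕ) : ℝ :=
  sphereMoment k (EuclideanSpace.single (0 : Fin n) (1 : ℝ))

theorem sphereMoment_eq [NeZero n] (k : ℕ) (v : EuclideanSpace ℝ (Fin n)) :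
    sphereMoment k v = ‖v‖ ^ k * coordMoment n k := by
  rw [coordMoment, ← sphereMoment_smul]
  exact sphereMoment_eq_of_norm_eq k (by simp [norm_smul])

theorem integral_coord_pow [NeZero n] (k : ℕ) (i : Fin n) :
    ∫ u : sphere (0 : EuclideanSpace ℝ (Fin n)) 1, (u : EuclideanSpace ℝ (Fin n)) i ^ k
      ∂(normalizedSphereMeasure n) = coordMoment n k := by
  have := sphereMoment_eq k (EuclideanSpace.single i (1 : ℝ))
  simpa [sphereMoment, EuclideanSpace.inner_single_right] using this

/-- The mixed moments `E[uᵢᵏ uⱼ²]` sum over `j` to `E[uᵢᵏ]`. -/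
theorem sum_integral_coord_pow_mul_sq [NeZero n] (k : ℕ) (i : Fin n) :
    ∑ j, ∫ u : sphere (0 : EuclideanSpace ℝ (Fin n)) 1,
      (u : EuclideanSpace ℝ (Fin n)) i ^ k * (u : EuclideanSpace ℝ (Fin n)) j ^ 2
      ∂(normalizedSphereMeasure n) = coordMoment n k := by
  rw [← integral_finsetSum _ fun j _ => integrable_normalizedSphereMeasure (by fun_prop),
    ← integral_coord_pow k i]
  refine integral_congr_ae (Filter.Eventually.of_forall fun u => ?_)
  have hu : ‖(u : EuclideanSpace ℝ (Fin n))‖ ^ 2 = 1 := by simp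
  rw [EuclideanSpace.real_norm_sq_eq] at hu
  simp only [← Finset.mul_sum, hu, mul_one]

theorem coordMoment_add_two [NeZero n] {k : ℕ} {X : ℝ}
    (h : ∀ j : Fin n, j ≠ 0 → ∫ u : sphere (0 : EuclideanSpace ℝ (Fin n)) 1,
      (u : EuclideanSpace ℝ (Fin n)) 0 ^ k * (u : EuclideanSpace ℝ (Fin n)) j ^ 2
      ∂(normalizedSphereMeasure n) = X) :
    coordMoment n (k + 2) + (n - 1) * X = coordMoment n k := by
  rw [← sum_integral_coord_pow_mul_sq k (0 : Fin n),
    ← Finset.add_sum_erase _ _ (Finset.mem_univ 0),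
    Finset.sum_congr rfl fun j hj => h j (Finset.ne_of_mem_erase hj)]
  have : (1 : ℕ) ≤ n := NeZero.one_le
  simp [← pow_add, integral_coord_pow, this]

/-- The average of `(uᵢ + a uⱼ)ᵏ + (uᵢ - a uⱼ)ᵏ` over the unit sphere, for `i ≠ j`. -/
theorem integral_add_pow_add_sub_pow [NeZero n] (k : ℕ) {i j : Fin n} (hij : i ≠ j) (a : ℝ) :
    ∫ u : sphere (0 : EuclideanSpace ℝ (Fin n)) 1,
      (((u : EuclideanSpace ℝ (Fin n)) i + a * (u : EuclideanSpace ℝ (Fin n)) j) ^ k +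
        ((u : EuclideanSpace ℝ (Fin n)) i - a * (u : EuclideanSpace ℝ (Fin n)) j) ^ k)
      ∂(normalizedSphereMeasure n) = 2 * (√(1 + a ^ 2) ^ k * coordMoment n k) := by
  have key : ∀ b : ℝ, ∫ u : sphere (0 : EuclideanSpace ℝ (Fin n)) 1,
      ((u : EuclideanSpace ℝ (Fin n)) i + b * (u : EuclideanSpace ℝ (Fin n)) j) ^ k
      ∂(normalizedSphereMeasure n) = √(1 + b ^ 2) ^ k * coordMoment n k := by
    intro b
    have h := sphereMoment_eq k
      (EuclideanSpace.single i (1 : ℝ) + EuclideanSpace.single j b)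
    have hn : ‖EuclideanSpace.single i (1 : ℝ) + EuclideanSpace.single j b‖ = √(1 + b ^ 2) := by
      rw [eq_comm, Real.sqrt_eq_iff_mul_self_eq (by positivity) (by positivity),
        ← sq, norm_add_sq_real]
      simp [EuclideanSpace.inner_single_right, hij.symm]
    rw [hn] at h
    simpa [sphereMoment, inner_add_right, EuclideanSpace.inner_single_right] using h
  have h2 := key (-a)
  simp only [neg_mul, ← sub_eq_add_neg, neg_sq] at h2
  rw [integral_add (integrable_normalizedSphereMeasure (by fun_prop))
    (integrable_normalizedSphereMeasure (by fun_prop)), key, h2, two_mul]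

theorem coordMoment_two [NeZero n] : n * coordMoment n 2 = 1 := by
  have h := sum_integral_coord_pow_mul_sq 0 (0 : Fin n)
  simp only [pow_zero, one_mul, integral_coord_pow] at h
  simpa [coordMoment, sphereMoment_zero] using h

theorem coordMoment_four [NeZero n] :
    (n + 2) * coordMoment n 4 = 3 * coordMoment n 2 := by
  have h := coordMoment_add_two (n := n) (k := 2) (X := coordMoment n 4 / 3) fun j hj => by
    have h1 := integral_add_pow_add_sub_pow 4 hj.symm 1
    have e : ∀ x y : ℝ, (x + 1 * y) ^ 4 + (x - 1 * y) ^ 4 =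
        2 * x ^ 4 + 2 * y ^ 4 + 12 * (x ^ 2 * y ^ 2) := fun x y => by ring
    have hs : √(1 + 1 ^ 2 : ℝ) ^ 4 = 4 := by
      rw [pow_mul √(1 + 1 ^ 2 : ℝ) 2 2, Real.sq_sqrt] <;> norm_num
    simp only [e, hs] at h1
    rw [integral_add (integrable_normalizedSphereMeasure (by fun_prop))
      (integrable_normalizedSphereMeasure (by fun_prop)),
      integral_add (integrable_normalizedSphereMeasure (by fun_prop))
      (integrable_normalizedSphereMeasure (by fun_prop))] at h1
    simp only [integral_const_mul, integral_coord_pow] at h1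
    linarith
  linarith

theorem coordMoment_six [NeZero n] :
    (n + 4) * coordMoment n 6 = 5 * coordMoment n 4 := by
  have h := coordMoment_add_two (n := n) (k := 4) (X := coordMoment n 6 / 5) fun j hj => by
    have h1 := integral_add_pow_add_sub_pow 6 hj.symm 1
    have h2 := integral_add_pow_add_sub_pow 6 hj.symm 2
    have e : ∀ a x y : ℝ, (x + a * y) ^ 6 + (x - a * y) ^ 6 =
        2 * x ^ 6 + 2 * a ^ 6 * y ^ 6 + 30 * a ^ 2 * (x ^ 4 * y ^ 2) +
          30 * a ^ 4 * (x ^ 2 * y ^ 4) := fun a x y => by ring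
    have hs : √(1 + 1 ^ 2 : ℝ) ^ 6 = 8 := by
      rw [pow_mul √(1 + 1 ^ 2 : ℝ) 2 3, Real.sq_sqrt] <;> norm_num
    have hs' : √(1 + 2 ^ 2 : ℝ) ^ 6 = 125 := by
      rw [pow_mul √(1 + 2 ^ 2 : ℝ) 2 3, Real.sq_sqrt] <;> norm_num
    simp only [e, hs] at h1
    simp only [e, hs'] at h2
    rw [integral_add (integrable_normalizedSphereMeasure (by fun_prop))
      (integrable_normalizedSphereMeasure (by fun_prop)),
      integral_add (integrable_normalizedSphereMeasure (by fun_prop))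
      (integrable_normalizedSphereMeasure (by fun_prop)),
      integral_add (integrable_normalizedSphereMeasure (by fun_prop))
      (integrable_normalizedSphereMeasure (by fun_prop))] at h1 h2
    simp only [integral_const_mul, integral_coord_pow] at h1 h2
    linarith
  linarith

end SphereMoments

section ZonalPolynomials

variable {n : ℕ}

/-- The polynomial `x ↦ ⟪x, y⟫ᵏ`. -/
noncomputable def zonalPoly (y : EuclideanSpace ℝ (Fin n)) (k : ℕ) : MvPolynomial (Fin n) ℝ :=
  (∑ i, C (y i) * X i) ^ k

/-- The polynomial `x ↦ ‖x‖² - c`. -/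
noncomputable def normSqSubPoly (n : ℕ) (c : ℝ) : MvPolynomial (Fin n) ℝ :=
  ∑ i, X i ^ 2 - C c

theorem eval_zonalPoly (x y : EuclideanSpace ℝ (Fin n)) (k : ℕ) :
    eval (x : Fin n → ℝ) (zonalPoly y k) = ⟪x, y⟫ ^ k := by
  simp [zonalPoly, PiLp.inner_apply, mul_comm]

theorem eval_normSqSubPoly (x : EuclideanSpace ℝ (Fin n)) (c : ℝ) :
    eval (x : Fin n → ℝ) (normSqSubPoly n c) = ‖x‖ ^ 2 - c := by
  simp [normSqSubPoly, EuclideanSpace.real_norm_sq_eq]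

theorem totalDegree_zonalPoly_le (y : EuclideanSpace ℝ (Fin n)) (k : ℕ) :
    (zonalPoly y k).totalDegree ≤ k := by
  refine (totalDegree_pow _ _).trans ?_
  have : (∑ i, C (y i) * X i : MvPolynomial (Fin n) ℝ).totalDegree ≤ 1 :=
    totalDegree_finsetSum_le fun i _ => (totalDegree_mul _ _).trans (by simp)
  simpa using Nat.mul_le_mul_left k this

theorem totalDegree_normSqSubPoly_le (c : ℝ) : (normSqSubPoly n c).totalDegree ≤ 2 := by
  refine (totalDegree_sub _ _).trans (max_le ?_ (by simp))
  exact totalDegree_finsetSum_le fun i _ => by simp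

theorem sphereAvg_eq_integral (r : ℝ) (f : MvPolynomial (Fin n) ℝ) :
    sphereAvg n r f = ∫ u : sphere (0 : EuclideanSpace ℝ (Fin n)) 1,
      eval ((r • (u : EuclideanSpace ℝ (Fin n)) : EuclideanSpace ℝ (Fin n)) : Fin n → ℝ) f
      ∂(normalizedSphereMeasure n) :=
  rfl

theorem sphereAvg_zonalPoly [NeZero n] (r : ℝ) (y : EuclideanSpace ℝ (Fin n)) (k : ℕ) :
    sphereAvg n r (zonalPoly y k) = r ^ k * ‖y‖ ^ k * coordMoment n k := by
  rw [sphereAvg_eq_integral, mul_assoc, ← sphereMoment_eq, sphereMoment, ← integral_const_mul]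
  simp only [eval_zonalPoly, real_inner_smul_left, mul_pow]

theorem sphereAvg_zonalPoly_mul_normSqSubPoly [NeZero n] (r c : ℝ)
    (y : EuclideanSpace ℝ (Fin n)) (k : ℕ) :
    sphereAvg n r (zonalPoly y k * normSqSubPoly n c) =
      (r ^ 2 - c) * (r ^ k * ‖y‖ ^ k * coordMoment n k) := by
  rw [← sphereAvg_zonalPoly, sphereAvg_eq_integral, sphereAvg_eq_integral, ← integral_const_mul]
  refine integral_congr_ae (Filter.Eventually.of_forall fun u => ?_)
  simp only [map_mul, eval_normSqSubPoly, norm_smul, norm_eq_of_mem_sphere]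
  rw [mul_one, Real.norm_eq_abs, sq_abs, mul_comm]

end ZonalPolynomials

section TwoSphereDesign

variable {X₁ X₂ : Finset (EuclideanSpace ℝ (Fin 22))} {w : EuclideanSpace ℝ (Fin 22) → ℝ}
  {r₁ r₂ : ℝ}

theorem IsEuclideanDesignTwoSpheres.symm {t : ℕ}
    (h : IsEuclideanDesignTwoSpheres t X₁ X₂ w r₁ r₂) :
    IsEuclideanDesignTwoSpheres t X₂ X₁ w r₂ r₁ := fun f hf => by
  rw [add_comm, h f hf, Finset.union_comm]

theorem disjoint_of_norm_eq (hrne : r₁ ≠ r₂) (hX₁ : ∀ x ∈ X₁, ‖x‖ = r₁)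
    (hX₂ : ∀ x ∈ X₂, ‖x‖ = r₂) : Disjoint X₁ X₂ :=
  Finset.disjoint_left.2 fun x h₁ h₂ => hrne ((hX₁ x h₁).symm.trans (hX₂ x h₂))

theorem IsEuclideanDesignTwoSpheres.sum_inner_pow {t : ℕ}
    (h : IsEuclideanDesignTwoSpheres t X₁ X₂ w r₁ r₂) (hd : Disjoint X₁ X₂)
    (y : EuclideanSpace ℝ (Fin 22)) {k : ℕ} (hk : k ≤ t) :
    ∑ x ∈ X₁, w x * ⟪x, y⟫ ^ k + ∑ x ∈ X₂, w x * ⟪x, y⟫ ^ k =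
      (∑ x ∈ X₁, w x) * (r₁ ^ k * ‖y‖ ^ k * coordMoment 22 k) +
        (∑ x ∈ X₂, w x) * (r₂ ^ k * ‖y‖ ^ k * coordMoment 22 k) := by
  have := h (zonalPoly y k) ((totalDegree_zonalPoly_le y k).trans hk)
  simp only [sphereAvg_zonalPoly, eval_zonalPoly, Finset.sum_union hd] at this
  exact this.symm

theorem IsEuclideanDesignTwoSpheres.sum_inner_pow_left {t : ℕ}
    (h : IsEuclideanDesignTwoSpheres t X₁ X₂ w r₁ r₂) (hr₁ : 0 < r₁) (hr₂ : 0 < r₂)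
    (hrne : r₁ ≠ r₂) (hX₁ : ∀ x ∈ X₁, ‖x‖ = r₁) (hX₂ : ∀ x ∈ X₂, ‖x‖ = r₂)
    (y : EuclideanSpace ℝ (Fin 22)) {k : ℕ} (hk : k + 2 ≤ t) :
    ∑ x ∈ X₁, w x * ⟪x, y⟫ ^ k =
      (∑ x ∈ X₁, w x) * (r₁ ^ k * ‖y‖ ^ k * coordMoment 22 k) := by
  have := h (zonalPoly y k * normSqSubPoly 22 (r₂ ^ 2)) ((totalDegree_mul _ _).trans
    ((add_le_add (totalDegree_zonalPoly_le y k) (totalDegree_normSqSubPoly_le _)).trans hk))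
  simp only [sphereAvg_zonalPoly_mul_normSqSubPoly, map_mul, eval_zonalPoly, eval_normSqSubPoly,
    Finset.sum_union (disjoint_of_norm_eq hrne hX₁ hX₂)] at this
  have e₁ : ∑ x ∈ X₁, w x * (⟪x, y⟫ ^ k * (‖x‖ ^ 2 - r₂ ^ 2)) =
      (∑ x ∈ X₁, w x * ⟪x, y⟫ ^ k) * (r₁ ^ 2 - r₂ ^ 2) := by
    rw [Finset.sum_mul]
    exact Finset.sum_congr rfl fun x hx => by rw [hX₁ x hx, mul_assoc]
  have e₂ : ∑ x ∈ X₂, w x * (⟪x, y⟫ ^ k * (‖x‖ ^ 2 - r₂ ^ 2)) = 0 :=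
    Finset.sum_eq_zero fun x hx => by rw [hX₂ x hx, sub_self, mul_zero, mul_zero]
  rw [e₁, e₂] at this
  have hne : r₁ ^ 2 - r₂ ^ 2 ≠ 0 := by
    rw [sq_sub_sq]
    exact mul_ne_zero (by positivity) (sub_ne_zero.2 hrne)
  apply mul_right_cancel₀ hne
  linear_combination -this

theorem coordMoment_twentyTwo :
    coordMoment 22 0 = 1 ∧ coordMoment 22 1 = 0 ∧ coordMoment 22 2 = 1 / 22 ∧
    coordMoment 22 3 = 0 ∧ coordMoment 22 4 = 1 / 176 ∧ coordMoment 22 5 = 0 ∧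
    coordMoment 22 6 = 5 / 4576 := by
  have h2 := coordMoment_two (n := 22)
  have h4 := coordMoment_four (n := 22)
  have h6 := coordMoment_six (n := 22)
  push_cast at h2 h4 h6
  refine ⟨sphereMoment_zero _, sphereMoment_of_odd (by decide) _, by linarith,
    sphereMoment_of_odd (by decide) _, by linarith, sphereMoment_of_odd (by decide) _,
    by linarith⟩

theorem sum_mul_cubic_sq {ι : Type*} (s : Finset ι) (w t : ι → ℝ) (a b c d : ℝ) :
    ∑ x ∈ s, w x * (a + b * t x + c * t x ^ 2 + d * t x ^ 3) ^ 2 =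
      a ^ 2 * ∑ x ∈ s, w x * t x ^ 0 + 2 * a * b * ∑ x ∈ s, w x * t x ^ 1 +
      (b ^ 2 + 2 * a * c) * ∑ x ∈ s, w x * t x ^ 2 +
      2 * (a * d + b * c) * ∑ x ∈ s, w x * t x ^ 3 +
      (c ^ 2 + 2 * b * d) * ∑ x ∈ s, w x * t x ^ 4 +
      2 * c * d * ∑ x ∈ s, w x * t x ^ 5 + d ^ 2 * ∑ x ∈ s, w x * t x ^ 6 := by
  simp only [Finset.mul_sum, ← Finset.sum_add_distrib]
  exact Finset.sum_congr rfl fun x _ => by ring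

/-- The part of the reproducing kernel coming from harmonics of degrees two and three, as a
function of `t = ⟪x, y⟫` and `q = ‖x‖² ‖y‖²`. -/
noncomputable def highKernel (b c q t : ℝ) : ℝ :=
  b * (t ^ 2 - q / 22) + c * (t ^ 3 - q * t / 8)

/-- The part of the reproducing kernel of a sphere of radius `r` and mass `W` coming from
harmonics of degrees zero and one. -/
noncomputable def lowKernel (W r t : ℝ) : ℝ :=
  (1 + 22 * t / r ^ 2) / W

theorem IsEuclideanDesignTwoSpheres.sum_kernel_sq
    (h : IsEuclideanDesignTwoSpheres 6 X₁ X₂ w r₁ r₂) (hr₁ : 0 < r₁) (hr₂ : 0 < r₂)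
    (hrne : r₁ ≠ r₂) (hX₁ : ∀ x ∈ X₁, ‖x‖ = r₁) (hX₂ : ∀ x ∈ X₂, ‖x‖ = r₂)
    {W₁ W₂ b c : ℝ} (hW₁ : ∑ x ∈ X₁, w x = W₁) (hW₂ : ∑ x ∈ X₂, w x = W₂) (hW : W₁ ≠ 0)
    (hb : b * (W₁ * r₁ ^ 4 + W₂ * r₂ ^ 4) = 264) (hc : c * (W₁ * r₁ ^ 6 + W₂ * r₂ ^ 6) = 2288)
    {y : EuclideanSpace ℝ (Fin 22)} (hy : ‖y‖ = r₁) :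
    ∑ x ∈ X₁, w x * (lowKernel W₁ r₁ ⟪x, y⟫ + highKernel b c (r₁ ^ 2 * r₁ ^ 2) ⟪x, y⟫) ^ 2 +
      ∑ x ∈ X₂, w x * highKernel b c (r₂ ^ 2 * r₁ ^ 2) ⟪x, y⟫ ^ 2 =
    lowKernel W₁ r₁ (r₁ ^ 2) + highKernel b c (r₁ ^ 2 * r₁ ^ 2) (r₁ ^ 2) := by
  have e₁ : ∀ t, lowKernel W₁ r₁ t + highKernel b c (r₁ ^ 2 * r₁ ^ 2) t =
      (1 / W₁ - b * r₁ ^ 4 / 22) + (22 / (r₁ ^ 2 * W₁) - c * r₁ ^ 4 / 8) * t + b * t ^ 2 +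
        c * t ^ 3 := fun t => by
    unfold lowKernel highKernel
    field_simp
    ring
  have e₂ : ∀ t, highKernel b c (r₂ ^ 2 * r₁ ^ 2) t =
      -(b * (r₂ ^ 2 * r₁ ^ 2) / 22) + -(c * (r₂ ^ 2 * r₁ ^ 2) / 8) * t + b * t ^ 2 +
        c * t ^ 3 := fun t => by
    unfold highKernel
    ring
  have m₁ {k : ℕ} (hk : k + 2 ≤ 6) := h.sum_inner_pow_left hr₁ hr₂ hrne hX₁ hX₂ y hk
  have m₂ {k : ℕ} (hk : k + 2 ≤ 6) := h.symm.sum_inner_pow_left hr₂ hr₁ hrne.symm hX₂ hX₁ y hk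
  have m {k : ℕ} (hk : k ≤ 6) := h.sum_inner_pow (disjoint_of_norm_eq hrne hX₁ hX₂) y hk
  obtain ⟨c0, c1, c2, c3, c4, c5, c6⟩ := coordMoment_twentyTwo
  have m5 := m (k := 5) (by norm_num)
  have m6 := m (k := 6) (by norm_num)
  rw [e₁]
  simp only [e₁, e₂]
  rw [sum_mul_cubic_sq, sum_mul_cubic_sq, m₁ (k := 0) (by norm_num), m₁ (k := 1) (by norm_num),
    m₁ (k := 2) (by norm_num), m₁ (k := 3) (by norm_num), m₁ (k := 4) (by norm_num),
    m₂ (k := 0) (by norm_num), m₂ (k := 1) (by norm_num),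
    m₂ (k := 2) (by norm_num), m₂ (k := 3) (by norm_num), m₂ (k := 4) (by norm_num)]
  rw [c5] at m5
  rw [c6] at m6
  rw [c0, c1, c2, c3, c4]
  rw [hW₁, hW₂, hy] at *
  have i1 : 1 / W₁ * W₁ = 1 := by field_simp
  have i2 : 22 / (r₁ ^ 2 * W₁) * (r₁ ^ 2 * W₁) = 22 := by field_simp
  generalize 1 / W₁ = p at *
  generalize 22 / (r₁ ^ 2 * W₁) = q at *
  linear_combination 2 * b * c * m5 + c ^ 2 * m6 + 7 / 1936 * r₁ ^ 4 * b * hb +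
    (5 / 4576 - 2 / (8 * 176) + 1 / (22 * 64)) * r₁ ^ 6 * c * hc + p * i1 + 1 / 22 * q * r₁ ^ 2 * i2

theorem eq_inv_of_sum_kernel_sq {ι : Type*} [DecidableEq ι] {s : Finset ι} {w : ι → ℝ}
    {K : ι → ι → ℝ} (hw : ∀ x ∈ s, 0 < w x)
    (hK : ∀ y ∈ s, ∑ x ∈ s, w x * K x y ^ 2 = K y y)
    (htr : ∑ y ∈ s, w y * K y y = s.card) {x y : ι} (hx : x ∈ s) (hy : y ∈ s) :
    K x y = if x = y then (w y)⁻¹ else 0 := by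
  have hsum : ∑ y ∈ s, ∑ x ∈ s,
      w y * (w x * (K x y - if x = y then (w y)⁻¹ else 0) ^ 2) = 0 := by
    have hin : ∀ y ∈ s, ∑ x ∈ s, w y * (w x * (K x y - if x = y then (w y)⁻¹ else 0) ^ 2) =
        1 - w y * K y y := by
      intro y hy
      have hwy := (hw y hy).ne'
      have : ∀ x ∈ s, w y * (w x * (K x y - if x = y then (w y)⁻¹ else 0) ^ 2) =
          w y * (w x * K x y ^ 2) + if x = y then 1 - 2 * w y * K y y else 0 := by
        intro x _
        split_ifs with hxy
        · subst hxy
          field_simp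
          ring
        · ring
      rw [Finset.sum_congr rfl this, Finset.sum_add_distrib, ← Finset.mul_sum, hK y hy,
        Finset.sum_ite_eq' s y, if_pos hy]
      ring
    rw [Finset.sum_congr rfl hin, Finset.sum_sub_distrib, htr]
    simp
  have hnn : ∀ y ∈ s, ∀ x ∈ s, 0 ≤ w y * (w x * (K x y - if x = y then (w y)⁻¹ else 0) ^ 2) :=
    fun y hy x hx => mul_nonneg (hw y hy).le (mul_nonneg (hw x hx).le (sq_nonneg _))
  have h₁ := (Finset.sum_eq_zero_iff_of_nonneg fun y hy => Finset.sum_nonneg (hnn y hy)).1 hsum y hy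
  have h₂ := (Finset.sum_eq_zero_iff_of_nonneg (hnn y hy)).1 h₁ x hx
  have h₃ := (mul_eq_zero.1 h₂).resolve_left (hw y hy).ne'
  have h₄ := (mul_eq_zero.1 h₃).resolve_left (hw x hx).ne'
  exact sub_eq_zero.1 ((pow_eq_zero_iff two_ne_zero).1 h₄)

/-- A Euclidean `6`-design of `2300` points on two spheres in `ℝ²²` is tight: its weight is
constant on each sphere, and the kernel vanishes between the two spheres. -/
theorem IsEuclideanDesignTwoSpheres.exists_of_card_eq
    (h : IsEuclideanDesignTwoSpheres 6 X₁ X₂ w r₁ r₂) (hr₁ : 0 < r₁) (hr₂ : 0 < r₂)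
    (hrne : r₁ ≠ r₂) (hX₁ : ∀ x ∈ X₁, ‖x‖ = r₁) (hX₂ : ∀ x ∈ X₂, ‖x‖ = r₂)
    (hw : ∀ x ∈ X₁ ∪ X₂, 0 < w x) (hcard : (X₁ ∪ X₂).card = 2300)
    (hne₁ : X₁.Nonempty) (hne₂ : X₂.Nonempty) :
    ∃ b c w₁ w₂ : ℝ, 0 < b ∧ 0 < c ∧ (∀ x ∈ X₁, w x = w₁) ∧ (∀ x ∈ X₂, w x = w₂) ∧
      ∀ x ∈ X₁, ∀ y ∈ X₂, highKernel b c (r₁ ^ 2 * r₂ ^ 2) ⟪x, y⟫ = 0 := by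
  have hd := disjoint_of_norm_eq hrne hX₁ hX₂
  obtain ⟨W₁, hW₁⟩ : ∃ W, ∑ x ∈ X₁, w x = W := ⟨_, rfl⟩
  obtain ⟨W₂, hW₂⟩ : ∃ W, ∑ x ∈ X₂, w x = W := ⟨_, rfl⟩
  have hp₁ : 0 < W₁ :=
    hW₁ ▸ Finset.sum_pos (fun x hx => hw x (Finset.mem_union_left _ hx)) hne₁
  have hp₂ : 0 < W₂ :=
    hW₂ ▸ Finset.sum_pos (fun x hx => hw x (Finset.mem_union_right _ hx)) hne₂
  obtain ⟨b, hb⟩ : ∃ b, b = 264 / (W₁ * r₁ ^ 4 + W₂ * r₂ ^ 4) := ⟨_, rfl⟩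
  obtain ⟨c, hc⟩ : ∃ c, c = 2288 / (W₁ * r₁ ^ 6 + W₂ * r₂ ^ 6) := ⟨_, rfl⟩
  have hb0 : 0 < b := by rw [hb]; positivity
  have hc0 : 0 < c := by rw [hc]; positivity
  replace hb : b * (W₁ * r₁ ^ 4 + W₂ * r₂ ^ 4) = 264 := by rw [hb]; field_simp
  replace hc : c * (W₁ * r₁ ^ 6 + W₂ * r₂ ^ 6) = 2288 := by rw [hc]; field_simp
  set K : EuclideanSpace ℝ (Fin 22) → EuclideanSpace ℝ (Fin 22) → ℝ := fun x y =>
    (if x ∈ X₁ ∧ y ∈ X₁ then lowKernel W₁ r₁ ⟪x, y⟫ else 0) +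
    (if x ∈ X₂ ∧ y ∈ X₂ then lowKernel W₂ r₂ ⟪x, y⟫ else 0) +
    highKernel b c (‖x‖ ^ 2 * ‖y‖ ^ 2) ⟪x, y⟫ with hKdef
  have n₁ : ∀ x ∈ X₁, x ∉ X₂ := fun x hx => Finset.disjoint_left.1 hd hx
  have n₂ : ∀ x ∈ X₂, x ∉ X₁ := fun x hx => Finset.disjoint_right.1 hd hx
  have K₁₁ : ∀ x ∈ X₁, ∀ y ∈ X₁, K x y =
      lowKernel W₁ r₁ ⟪x, y⟫ + highKernel b c (r₁ ^ 2 * r₁ ^ 2) ⟪x, y⟫ := fun x hx y hy => by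
    simp [hKdef, hx, hy, n₁ x hx, hX₁]
  have K₂₂ : ∀ x ∈ X₂, ∀ y ∈ X₂, K x y =
      lowKernel W₂ r₂ ⟪x, y⟫ + highKernel b c (r₂ ^ 2 * r₂ ^ 2) ⟪x, y⟫ := fun x hx y hy => by
    simp [hKdef, hx, hy, n₂ x hx, hX₂]
  have K₁₂ : ∀ x ∈ X₁, ∀ y ∈ X₂, K x y = highKernel b c (r₁ ^ 2 * r₂ ^ 2) ⟪x, y⟫ :=
    fun x hx y hy => by simp [hKdef, hx, hy, n₁ x hx, n₂ y hy, hX₁, hX₂]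
  have K₂₁ : ∀ x ∈ X₂, ∀ y ∈ X₁, K x y = highKernel b c (r₂ ^ 2 * r₁ ^ 2) ⟪x, y⟫ :=
    fun x hx y hy => by simp [hKdef, hx, hy, n₂ x hx, n₁ y hy, hX₁, hX₂]
  have d₁ : ∀ y ∈ X₁, K y y =
      lowKernel W₁ r₁ (r₁ ^ 2) + highKernel b c (r₁ ^ 2 * r₁ ^ 2) (r₁ ^ 2) := fun y hy => by
    rw [K₁₁ y hy y hy, real_inner_self_eq_norm_sq, hX₁ y hy]
  have d₂ : ∀ y ∈ X₂, K y y =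
      lowKernel W₂ r₂ (r₂ ^ 2) + highKernel b c (r₂ ^ 2 * r₂ ^ 2) (r₂ ^ 2) := fun y hy => by
    rw [K₂₂ y hy y hy, real_inner_self_eq_norm_sq, hX₂ y hy]
  have hK : ∀ y ∈ X₁ ∪ X₂, ∑ x ∈ X₁ ∪ X₂, w x * K x y ^ 2 = K y y := by
    intro y hy
    rw [Finset.sum_union hd]
    rcases Finset.mem_union.1 hy with hy | hy
    · rw [d₁ y hy, ← h.sum_kernel_sq hr₁ hr₂ hrne hX₁ hX₂ hW₁ hW₂ hp₁.ne' hb hc (hX₁ y hy),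
        Finset.sum_congr rfl fun x hx => by rw [K₁₁ x hx y hy],
        Finset.sum_congr (s₁ := X₂) rfl fun x hx => by rw [K₂₁ x hx y hy]]
    · rw [add_comm, d₂ y hy, ← h.symm.sum_kernel_sq hr₂ hr₁ hrne.symm hX₂ hX₁ hW₂ hW₁ hp₂.ne'
        (by rwa [add_comm]) (by rwa [add_comm]) (hX₂ y hy),
        Finset.sum_congr (s₁ := X₂) rfl fun x hx => by rw [K₂₂ x hx y hy],
        Finset.sum_congr (s₁ := X₁) rfl fun x hx => by rw [K₁₂ x hx y hy]]
  have htr : ∑ y ∈ X₁ ∪ X₂, w y * K y y = (X₁ ∪ X₂).card := by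
    rw [hcard, Finset.sum_union hd, Finset.sum_congr rfl fun x hx => by rw [d₁ x hx],
      Finset.sum_congr (s₁ := X₂) rfl fun x hx => by rw [d₂ x hx], ← Finset.sum_mul,
      ← Finset.sum_mul, hW₁, hW₂]
    have l₁ : W₁ * lowKernel W₁ r₁ (r₁ ^ 2) = 23 := by
      unfold lowKernel
      field_simp
      norm_num
    have l₂ : W₂ * lowKernel W₂ r₂ (r₂ ^ 2) = 23 := by
      unfold lowKernel
      field_simp
      norm_num
    unfold highKernel
    push_cast
    linear_combination l₁ + l₂ + 21 / 22 * hb + 7 / 8 * hc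
  have key {x y} := eq_inv_of_sum_kernel_sq hw hK htr (x := x) (y := y)
  refine ⟨b, c, (lowKernel W₁ r₁ (r₁ ^ 2) + highKernel b c (r₁ ^ 2 * r₁ ^ 2) (r₁ ^ 2))⁻¹,
    (lowKernel W₂ r₂ (r₂ ^ 2) + highKernel b c (r₂ ^ 2 * r₂ ^ 2) (r₂ ^ 2))⁻¹, hb0, hc0,
    fun x hx => ?_, fun x hx => ?_, fun x hx y hy => ?_⟩
  · rw [← d₁ x hx, key (by simp [hx]) (by simp [hx]), if_pos rfl, inv_inv]
  · rw [← d₂ x hx, key (by simp [hx]) (by simp [hx]), if_pos rfl, inv_inv]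
  · rw [← K₁₂ x hx y hy, key (by simp [hx]) (by simp [hy]), if_neg]
    rintro rfl
    exact n₁ x hx hy

end TwoSphereDesign

section CubicCounts

theorem exists_cubic_factorization {C : ℝ} (hC : 0 < C) :
    ∃ α β γ : ℝ, 1 < α ∧ -1 < β ∧ β < 1 ∧ γ < -1 ∧
      ∀ u : ℝ, u ^ 3 + C * u ^ 2 - 11 / 4 * u - C = (u - α) * (u - β) * (u - γ) := by
  have hcont : Continuous fun u : ℝ => u ^ 3 + C * u ^ 2 - 11 / 4 * u - C := by fun_prop
  obtain ⟨α, ⟨hα, -⟩, h₁⟩ := intermediate_value_Ioo (show (1 : ℝ) ≤ 2 by norm_num)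
    hcont.continuousOn (show (0 : ℝ) ∈ _ from ⟨by norm_num; linarith, by norm_num; linarith⟩)
  obtain ⟨β, ⟨hβ, hβ'⟩, h₂⟩ := intermediate_value_Ioo' (show (-1 : ℝ) ≤ 1 by norm_num)
    hcont.continuousOn (show (0 : ℝ) ∈ _ from ⟨by norm_num; linarith, by norm_num; linarith⟩)
  simp only at h₁ h₂
  have hne : α - β ≠ 0 := by linarith
  have e₂ : α * β + (α + β) * (-C - α - β) = -11 / 4 := by
    apply mul_left_cancel₀ hne
    linear_combination -h₁ + h₂
  have hfac : ∀ u : ℝ, u ^ 3 + C * u ^ 2 - 11 / 4 * u - C =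
      (u - α) * (u - β) * (u - (-C - α - β)) := fun u => by
    linear_combination h₁ + (α - u) * e₂
  refine ⟨α, β, -C - α - β, hα, hβ, hβ', ?_, hfac⟩
  have h₃ := hfac (-1)
  by_contra! hcon
  nlinarith [mul_nonneg (mul_pos (show 0 < 1 + α by linarith) (show 0 < 1 + β by linarith)).le
    (show 0 ≤ 1 + (-C - α - β) by linarith)]

theorem sum_comp_eq_of_cubic {ι : Type*} {s : Finset ι} {u : ι → ℝ} {α β γ : ℝ} (hαβ : α ≠ β)
    (hαγ : α ≠ γ) (hβγ : β ≠ γ) (hu : ∀ x ∈ s, (u x - α) * (u x - β) * (u x - γ) = 0)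
    (f : ℝ → ℝ) :
    ∑ x ∈ s, f (u x) = (s.filter fun x => u x = α).card * f α +
      (s.filter fun x => u x = β).card * f β + (s.filter fun x => u x = γ).card * f γ := by
  have h : ∀ x ∈ s, f (u x) = (if u x = α then f α else 0) + (if u x = β then f β else 0) +
      (if u x = γ then f γ else 0) := by
    intro x hx
    rcases mul_eq_zero.1 (hu x hx) with h | h
    · rcases mul_eq_zero.1 h with h | h
      · simp [sub_eq_zero.1 h, hαβ, hαγ]
      · simp [sub_eq_zero.1 h, hαβ.symm, hβγ]
    · simp [sub_eq_zero.1 h, hαγ.symm, hβγ.symm]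
  rw [Finset.sum_congr rfl h, Finset.sum_add_distrib, Finset.sum_add_distrib]
  simp [← Finset.sum_filter]

/-- The Christoffel number of a node of a three-point quadrature whose nodes are the roots of
`u³ + C u² - (11/4) u - C`. -/
theorem christoffel_of_cubic {α β γ n₁ n₂ n₃ N : ℝ} (h₂ : α * β + α * γ + β * γ = -11 / 4)
    (h₃ : α * β * γ = -(α + β + γ)) (s₀ : n₁ + n₂ + n₃ = N)
    (s₁ : n₁ * α + n₂ * β + n₃ * γ = 0) (s₂ : n₁ * α ^ 2 + n₂ * β ^ 2 + n₃ * γ ^ 2 = N) :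
    n₁ * (4 * α ^ 4 - α ^ 2 + 11) = 7 * N := by
  have hn : n₁ * ((α - β) * (α - γ)) = N * (1 + β * γ) := by
    linear_combination s₂ - (β + γ) * s₁ + β * γ * s₀
  have hS : (β + γ) * (α ^ 2 - 1) = -7 / 4 * α := by linear_combination α * h₂ - h₃
  have hP : β * γ * (α ^ 2 - 1) = -α ^ 2 + 11 / 4 := by
    linear_combination (α ^ 2 - 1) * h₂ - α * hS
  linear_combination 4 * (α ^ 2 - 1) * hn + 4 * n₁ * α * hS - 4 * n₁ * hP + 4 * N * hP

theorem lt_of_christoffel_outer {C γ : ℝ} {k : ℕ} (hγ : γ < -1)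
    (hC : C * (γ ^ 2 - 1) = -γ * (γ ^ 2 - 11 / 4))
    (hk : k * (4 * γ ^ 4 - γ ^ 2 + 11) = 175) : C < 257 / 100 := by
  have hk₀ : (1 : ℝ) ≤ k := by
    rw [Nat.one_le_cast, Nat.one_le_iff_ne_zero]
    rintro rfl
    norm_num at hk
  have hv : 1 < γ ^ 2 := by nlinarith
  have hg : 4 * (γ ^ 2) ^ 2 - γ ^ 2 + 11 ≤ 175 := by
    have h := mul_nonneg (sub_nonneg.2 hk₀)
      (show 0 ≤ 4 * γ ^ 4 - γ ^ 2 + 11 by nlinarith only [sq_nonneg (8 * γ ^ 2 - 1)])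
    linear_combination h + hk
  have hv' : γ ^ 2 ≤ 66 / 10 := by
    by_contra! h
    nlinarith only [h, hg]
  have hγ' : -γ ≤ 257 / 100 := by nlinarith only [hv', hγ]
  have h : C < -γ := by
    by_contra! h
    nlinarith only [mul_le_mul_of_nonneg_right h (sub_pos.2 hv).le, hC, hγ]
  linarith

theorem eq_of_christoffel_middle {C β : ℝ} {k : ℕ} (hβ : -1 < β) (hβ' : β < 1) (hC : 0 < C)
    (hC' : C < 257 / 100) (h : C * (1 - β ^ 2) = -β * (11 / 4 - β ^ 2))
    (hk : k * (4 * β ^ 4 - β ^ 2 + 11) = 175) : β < 0 ∧ k = 16 := by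
  have hv : β ^ 2 < 1 := by nlinarith only [hβ, hβ']
  have hβ0 : β < 0 := by
    by_contra! hcon
    nlinarith only [mul_pos hC (sub_pos.2 hv), h,
      mul_nonneg hcon (show 0 ≤ 11 / 4 - β ^ 2 by linarith)]
  have hg₀ : 175 ≤ 16 * (4 * β ^ 4 - β ^ 2 + 11) := by
    nlinarith only [sq_nonneg (8 * β ^ 2 - 1)]
  refine ⟨hβ0, le_antisymm ?_ ?_⟩
  · by_contra! hcon
    have : (17 : ℝ) ≤ k := by exact_mod_cast hcon
    have := mul_le_mul_of_nonneg_right this (show 0 ≤ 4 * β ^ 4 - β ^ 2 + 11 by linarith)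
    linarith
  · by_contra! hcon
    have : (k : ℝ) ≤ 15 := by exact_mod_cast Nat.le_of_lt_succ hcon
    have := mul_le_mul_of_nonneg_right this (show 0 ≤ 4 * β ^ 4 - β ^ 2 + 11 by linarith)
    have hv' : 55 / 100 ≤ β ^ 2 := by
      by_contra! hlt
      nlinarith only [mul_nonneg (sq_nonneg β) (sub_pos.2 hlt).le, hlt, this, hk]
    have hβ'' : 74 / 100 ≤ -β := by nlinarith only [hv', hβ0]
    nlinarith only [h, hC', hC, hβ'', hv, hv', mul_nonneg hC.le (sub_nonneg.2 hv'),
      mul_nonneg (sub_nonneg.2 hβ'') (show 0 ≤ 7 / 4 - (β ^ 2 - 1) by linarith)]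

/-- Integrality of the intersection numbers of both fibers determines the cubic. -/
theorem roots_and_counts_of_cubic {C α β γ : ℝ} {n₁ n₂ n₃ m₁ m₂ m₃ : ℕ} (hα : 1 < α)
    (hβ : -1 < β) (hβ' : β < 1) (hγ : γ < -1) (hC : 0 < C)
    (hp : ∀ u : ℝ, u ^ 3 + C * u ^ 2 - 11 / 4 * u - C = (u - α) * (u - β) * (u - γ))
    (s₀ : (n₁ + n₂ + n₃ : ℝ) = 275) (s₁ : n₁ * α + n₂ * β + n₃ * γ = 0)
    (s₂ : n₁ * α ^ 2 + n₂ * β ^ 2 + n₃ * γ ^ 2 = 275)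
    (t₀ : (m₁ + m₂ + m₃ : ℝ) = 2025) (t₁ : m₁ * α + m₂ * β + m₃ * γ = 0)
    (t₂ : m₁ * α ^ 2 + m₂ * β ^ 2 + m₃ * γ ^ 2 = 2025) :
    (α = √2 ∧ β = √2 * (-1 / 4) ∧ γ = √2 * (-3 / 2)) ∧ n₁ = 77 ∧ n₂ = 176 ∧ n₃ = 22 := by
  have p0 := hp 0
  have p1 := hp 1
  have pm := hp (-1)
  have h₁ : α + β + γ = -C := by linarith
  have h₂ : α * β + α * γ + β * γ = -11 / 4 := by linarith
  have h₃ : α * β * γ = C := by linarith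
  have n₁e := christoffel_of_cubic h₂ (by linarith) s₀ s₁ s₂
  have n₂e := christoffel_of_cubic (α := β) (β := α) (γ := γ) (n₁ := n₂) (n₂ := n₁) (n₃ := n₃)
    (N := 275) (by linarith) (by linarith) (by linarith) (by linarith) (by linarith)
  have n₃e := christoffel_of_cubic (α := γ) (β := α) (γ := β) (n₁ := n₃) (n₂ := n₁) (n₃ := n₂)
    (N := 275) (by linarith) (by linarith) (by linarith) (by linarith) (by linarith)
  have m₂e := christoffel_of_cubic (α := β) (β := α) (γ := γ) (n₁ := m₂) (n₂ := m₁) (n₃ := m₃)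
    (N := 2025) (by linarith) (by linarith) (by linarith) (by linarith) (by linarith)
  have m₃e := christoffel_of_cubic (α := γ) (β := α) (γ := β) (n₁ := m₃) (n₂ := m₁) (n₃ := m₂)
    (N := 2025) (by linarith) (by linarith) (by linarith) (by linarith) (by linarith)
  have hdvd : ∀ {n m : ℕ} {x : ℝ}, n * (4 * x ^ 4 - x ^ 2 + 11) = 7 * 275 →
      m * (4 * x ^ 4 - x ^ 2 + 11) = 7 * 2025 → ∃ k : ℕ, n = 11 * k := by
    intro n m x hn hm
    have hx : (4 * x ^ 4 - x ^ 2 + 11) ≠ 0 := by nlinarith [sq_nonneg (8 * x ^ 2 - 1)]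
    have : (81 * n : ℝ) = 11 * m := by
      apply mul_right_cancel₀ hx
      linear_combination 81 * hn - 11 * hm
    have : 81 * n = 11 * m := by exact_mod_cast this
    exact ⟨n / 11, by omega⟩
  obtain ⟨k₂, rfl⟩ := hdvd n₂e m₂e
  obtain ⟨k₃, rfl⟩ := hdvd n₃e m₃e
  have k₂e : k₂ * (4 * β ^ 4 - β ^ 2 + 11) = 175 := by push_cast at n₂e; linarith
  have k₃e : k₃ * (4 * γ ^ 4 - γ ^ 2 + 11) = 175 := by push_cast at n₃e; linarith
  have hC3 := lt_of_christoffel_outer (C := C) hγ (by linear_combination hp γ) k₃e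
  have hCβ : C * (1 - β ^ 2) = -β * (11 / 4 - β ^ 2) := by linear_combination -hp β
  obtain ⟨hβ0, hk⟩ := eq_of_christoffel_middle hβ hβ' hC hC3 hCβ k₂e
  subst hk
  have hv8 : β ^ 2 = 1 / 8 := by
    push_cast at k₂e
    have : (8 * β ^ 2 - 1) ^ 2 = 0 := by linear_combination k₂e
    linarith [(pow_eq_zero_iff two_ne_zero).1 this]
  have hs : √2 ^ 2 = (2 : ℝ) := Real.sq_sqrt (by norm_num)
  have hs0 : 0 < √2 := by positivity
  have hβs : β = √2 * (-1 / 4) := by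
    have : (β - √2 / 4) * (β + √2 / 4) = 0 := by linear_combination hv8 - hs / 16
    rcases mul_eq_zero.1 this with h | h <;> linarith
  have hCs : C = 3 / 4 * √2 := by
    rw [hv8] at hCβ
    linarith
  have hαγ : α * γ = -3 := by
    have h : √2 * (α * γ + 3) = 0 := by
      rw [hβs, hCs] at h₃
      linear_combination -4 * h₃
    linarith [(mul_eq_zero.1 h).resolve_left hs0.ne']
  have hαs : α = √2 := by
    have : (α - √2) * (α + 3 / 2 * √2) = 0 := by
      linear_combination α * h₁ - hαγ - α * hβs - α * hCs - 3 / 2 * hs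
    rcases mul_eq_zero.1 this with h | h <;> linarith
  have hγs : γ = √2 * (-3 / 2) := by linarith
  have hn₁ : n₁ = 77 := by
    have : (n₁ : ℝ) = 77 := by
      rw [hαs, show √2 ^ 4 = (√2 ^ 2) ^ 2 by ring, hs] at n₁e
      linarith
    exact_mod_cast this
  refine ⟨⟨hαs, hβs, hγs⟩, hn₁, rfl, ?_⟩
  have : n₁ + 11 * 16 + 11 * k₃ = 275 := by exact_mod_cast s₀
  omega

end CubicCounts

section MainProof

variable {X₁ X₂ : Finset (EuclideanSpace ℝ (Fin 22))}
  {w : EuclideanSpace ℝ (Fin 22) → ℝ} {r₁ r₂ : ℝ}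

theorem IsEuclideanDesignTwoSpheres.sum_inner_pow_of_const {t : ℕ}
    (h : IsEuclideanDesignTwoSpheres t X₁ X₂ w r₁ r₂) (hr₁ : 0 < r₁) (hr₂ : 0 < r₂)
    (hrne : r₁ ≠ r₂) (hX₁ : ∀ x ∈ X₁, ‖x‖ = r₁) (hX₂ : ∀ x ∈ X₂, ‖x‖ = r₂) {w₁ : ℝ}
    (hw₁ : w₁ ≠ 0) (hw : ∀ x ∈ X₁, w x = w₁) (y : EuclideanSpace ℝ (Fin 22)) {k : ℕ}
    (hk : k + 2 ≤ t) :
    ∑ x ∈ X₁, ⟪x, y⟫ ^ k = X₁.card * (r₁ ^ k * ‖y‖ ^ k * coordMoment 22 k) := by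
  have := h.sum_inner_pow_left hr₁ hr₂ hrne hX₁ hX₂ y hk
  rw [Finset.sum_congr rfl fun x hx => by rw [hw x hx], ← Finset.mul_sum,
    Finset.sum_congr rfl hw, Finset.sum_const, nsmul_eq_mul] at this
  apply mul_left_cancel₀ hw₁
  linear_combination this

theorem card_fibers_of_cubic {t : ℕ}
    (h : IsEuclideanDesignTwoSpheres t X₁ X₂ w r₁ r₂) (ht : 4 ≤ t) (hr₁ : 0 < r₁) (hr₂ : 0 < r₂)
    (hrne : r₁ ≠ r₂) (hX₁ : ∀ x ∈ X₁, ‖x‖ = r₁) (hX₂ : ∀ x ∈ X₂, ‖x‖ = r₂) {w₁ : ℝ}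
    (hw₁ : w₁ ≠ 0) (hw : ∀ x ∈ X₁, w x = w₁) {y : EuclideanSpace ℝ (Fin 22)} (hy : ‖y‖ = r₂)
    {α β γ : ℝ} (hαβ : α ≠ β) (hαγ : α ≠ γ) (hβγ : β ≠ γ) {a : ℝ}
    (ha : a ^ 2 * (r₁ ^ 2 * r₂ ^ 2) = 22)
    (hu : ∀ x ∈ X₁, (a * ⟪x, y⟫ - α) * (a * ⟪x, y⟫ - β) * (a * ⟪x, y⟫ - γ) = 0) :
    ∃ n₁ n₂ n₃ : ℕ, n₁ = (X₁.filter fun x => a * ⟪x, y⟫ = α).card ∧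
      n₂ = (X₁.filter fun x => a * ⟪x, y⟫ = β).card ∧
      n₃ = (X₁.filter fun x => a * ⟪x, y⟫ = γ).card ∧ (n₁ + n₂ + n₃ : ℝ) = X₁.card ∧
      n₁ * α + n₂ * β + n₃ * γ = 0 ∧ n₁ * α ^ 2 + n₂ * β ^ 2 + n₃ * γ ^ 2 = X₁.card := by
  have key := sum_comp_eq_of_cubic hαβ hαγ hβγ hu
  obtain ⟨c0, c1, c2, -⟩ := coordMoment_twentyTwo
  have m {k : ℕ} (hk : k + 2 ≤ 4) :=
    h.sum_inner_pow_of_const hr₁ hr₂ hrne hX₁ hX₂ hw₁ hw y (hk.trans ht)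
  have m1 := m (k := 1) (by norm_num)
  have m2 := m (k := 2) (by norm_num)
  rw [c1] at m1
  rw [c2, hy] at m2
  simp only [pow_one] at m1
  refine ⟨_, _, _, rfl, rfl, rfl, ?_, ?_, ?_⟩
  · have := key fun _ => 1
    simp only [Finset.sum_const, nsmul_eq_mul, mul_one] at this
    exact this.symm
  · have := key fun v => v
    rw [← Finset.mul_sum, m1] at this
    linarith
  · have := key fun v => v ^ 2
    simp only [mul_pow] at this
    rw [← Finset.mul_sum, m2] at this
    linear_combination -this + X₁.card / 22 * ha

end MainProof

/-- each point of `X₂` has inner product `r₁r₂/√11` with exactly 77 points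
of `X₁`, `-r₁r₂/(4√11)` with exactly 176 points, and `-3r₁r₂/(2√11)` with exactly 22. -/
theorem statement10
    {X₁ X₂ : Finset (EuclideanSpace ℝ (Fin 22))} {w : EuclideanSpace ℝ (Fin 22) → ℝ}
    {r₁ r₂ : ℝ} (hr₁ : 0 < r₁) (hr₂ : 0 < r₂) (hrne : r₁ ≠ r₂)
    (hX₁ : ∀ x ∈ X₁, ‖x‖ = r₁) (hX₂ : ∀ x ∈ X₂, ‖x‖ = r₂)
    (hw : ∀ x ∈ X₁ ∪ X₂, 0 < w x)
    (hcard : (X₁ ∪ X₂).card = 2300) (hcard₁ : X₁.card = 275)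
    (hdesign : IsEuclideanDesignTwoSpheres 6 X₁ X₂ w r₁ r₂) :
    ∀ y ∈ X₂,
      (X₁.filter fun x => ⟪x, y⟫ = r₁ * r₂ / Real.sqrt 11).card = 77 ∧
      (X₁.filter fun x => ⟪x, y⟫ = -(r₁ * r₂ / (4 * Real.sqrt 11))).card = 176 ∧
      (X₁.filter fun x => ⟪x, y⟫ = -(3 * r₁ * r₂ / (2 * Real.sqrt 11))).card = 22 := by
  have hd := disjoint_of_norm_eq hrne hX₁ hX₂
  have hcard₂ : X₂.card = 2025 := by
    rw [Finset.card_union_of_disjoint hd] at hcard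
    omega
  have hne₁ : X₁.Nonempty := Finset.card_pos.1 (by omega)
  have hne₂ : X₂.Nonempty := Finset.card_pos.1 (by omega)
  obtain ⟨b, c, w₁, w₂, hb, hc, hw₁, hw₂, hker⟩ :=
    hdesign.exists_of_card_eq hr₁ hr₂ hrne hX₁ hX₂ hw hcard hne₁ hne₂
  obtain ⟨x₀, hx₀⟩ := hne₁
  have hw₁0 : w₁ ≠ 0 := hw₁ x₀ hx₀ ▸ (hw x₀ (Finset.mem_union_left _ hx₀)).ne'
  intro y hy
  have hw₂0 : w₂ ≠ 0 := hw₂ y hy ▸ (hw y (Finset.mem_union_right _ hy)).ne'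
  have h2 : √2 ^ 2 = (2 : ℝ) := Real.sq_sqrt (by norm_num)
  have h11 : √11 ^ 2 = (11 : ℝ) := Real.sq_sqrt (by norm_num)
  have h2' : 0 < √2 := by positivity
  have h11' : 0 < √11 := by positivity
  obtain ⟨a, ha⟩ : ∃ a, a = √2 * √11 / (r₁ * r₂) := ⟨_, rfl⟩
  have ha0 : 0 < a := ha ▸ by positivity
  have har : a * (r₁ * r₂) = √2 * √11 := by rw [ha]; field_simp
  have ha2 : a ^ 2 * (r₁ ^ 2 * r₂ ^ 2) = 22 := by
    linear_combination (a * (r₁ * r₂) + √2 * √11) * har + √11 ^ 2 * h2 + 2 * h11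
  have hC : 0 < b * a / c := by positivity
  obtain ⟨α, β, γ, hα, hβ, hβ', hγ, hp⟩ := exists_cubic_factorization hC
  have hu : ∀ x ∈ X₁, ∀ y ∈ X₂,
      (a * ⟪x, y⟫ - α) * (a * ⟪x, y⟫ - β) * (a * ⟪x, y⟫ - γ) = 0 := by
    intro x hx y hy
    rw [← hp]
    have := hker x hx y hy
    rw [highKernel] at this
    have hCc : b * a / c * c = b * a := by field_simp
    apply mul_left_cancel₀ hc.ne'
    generalize b * a / c = C at *
    linear_combination a ^ 3 * this + ((a * ⟪x, y⟫) ^ 2 - 1) * hCc +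
      (b * a / 22 + c * a * ⟪x, y⟫ / 8) * ha2
  have hαβ : α ≠ β := by linarith
  have hαγ : α ≠ γ := by linarith
  have hβγ : β ≠ γ := by linarith
  obtain ⟨n₁, n₂, n₃, e₁, e₂, e₃, s₀, s₁, s₂⟩ := card_fibers_of_cubic hdesign (by norm_num)
    hr₁ hr₂ hrne hX₁ hX₂ hw₁0 hw₁ (hX₂ y hy) hαβ hαγ hβγ ha2 fun x hx => hu x hx y hy
  obtain ⟨m₁, m₂, m₃, -, -, -, t₀, t₁, t₂⟩ := card_fibers_of_cubic hdesign.symm (by norm_num)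
    hr₂ hr₁ hrne.symm hX₂ hX₁ hw₂0 hw₂ (hX₁ x₀ hx₀) hαβ hαγ hβγ
    (a := a) (by linear_combination ha2)
    fun x hx => by
      rw [real_inner_comm]
      exact hu x₀ hx₀ x hx
  rw [hcard₁] at s₀ s₂
  rw [hcard₂] at t₀ t₂
  obtain ⟨⟨hα, hβ, hγ⟩, hn₁, hn₂, hn₃⟩ := roots_and_counts_of_cubic hα hβ hβ' hγ hC hp
    (by exact_mod_cast s₀) s₁ (by exact_mod_cast s₂) (by exact_mod_cast t₀) t₁
    (by exact_mod_cast t₂)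
  have hiff {v κ d : ℝ} (hd : a * d = κ) : v = d ↔ a * v = κ := by
    rw [← hd, mul_right_inj' ha0.ne']
  have d₁ : a * (r₁ * r₂ / √11) = α := by
    rw [ha, hα]
    field_simp
  have d₂ : a * -(r₁ * r₂ / (4 * √11)) = β := by
    rw [ha, hβ]
    field_simp
  have d₃ : a * -(3 * r₁ * r₂ / (2 * √11)) = γ := by
    rw [ha, hγ]
    field_simp
  simp only [hiff d₁, hiff d₂, hiff d₃]
  exact ⟨e₁ ▸ hn₁, e₂ ▸ hn₂, e₃ ▸ hn₃⟩
end

section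
/- Let Λ be an even unimodular lattice in ℝ^24 of minimal norm 4 (the Leech lattice), and let A, B ∈ Λ with ⟨A,A⟩ = ⟨B,B⟩ = 4 and ⟨A,B⟩ = −1. Then the set X1⁰ = { x ∈ Λ : ⟨x,x⟩ = 6, ⟨x,A⟩ = 3, ⟨x,B⟩ = −3 } has exactly 275 elements. -/
open MeasureTheory Metric MvPolynomial
open scoped RealInnerProductSpace Classical

local notation "E₂₄" => EuclideanSpace ℝ (Fin 24)

section PoissonPi

open Complex UnitAddTorus
open scoped Real

theorem isOpenQuotientMap_coe_unitAddTorus {ι : Type*} :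
    IsOpenQuotientMap (fun (x : ι → ℝ) (i : ι) => (x i : UnitAddCircle)) :=
  IsOpenQuotientMap.piMap fun _ => QuotientAddGroup.isOpenQuotientMap_mk

variable {ι : Type*} [Fintype ι]

theorem mFourier_apply_coe (n : ι → ℤ) (x : ι → ℝ) :
    mFourier n (fun i => (x i : UnitAddCircle)) = cexp (2 * π * I * ∑ i, n i * x i) := by
  simp only [mFourier, ContinuousMap.coe_mk, fourier_coe_apply]
  rw [← Complex.exp_sum]
  congr 1
  push_cast
  rw [Finset.mul_sum]
  refine Finset.sum_congr rfl fun i _ => ?_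
  ring

theorem integral_eq_tsum_unitCube {g : (ι → ℝ) → ℂ} (hg : Integrable g) :
    ∫ x, g x = ∑' n : ι → ℤ, ∫ x in {x : ι → ℝ | ∀ i, x i ∈ Set.Ioc (0 : ℝ) (0 + 1)},
      g (x + fun i => (n i : ℝ)) := by
  set D : Set (ι → ℝ) := {x : ι → ℝ | ∀ i, x i ∈ Set.Ioc (0 : ℝ) (0 + 1)} with hD
  have hDm : MeasurableSet D := MeasurableSet.univ_pi' fun i => measurableSet_Ioc
  let s : (ι → ℤ) → Set (ι → ℝ) := fun n => (fun x => x + fun i => (-n i : ℝ)) ⁻¹' D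
  have hs (n : ι → ℤ) : MeasurableSet (s n) := (measurable_add_const _) hDm
  have hU : (⋃ n, s n) = Set.univ := by
    refine Set.eq_univ_of_forall fun x => Set.mem_iUnion.2 ⟨fun i => ⌈x i⌉ - 1, fun i => ?_⟩
    have h1 := Int.ceil_lt_add_one (x i)
    have h2 := Int.le_ceil (x i)
    simp only [Pi.add_apply, Int.cast_sub, Int.cast_one, Set.mem_Ioc]
    constructor <;> linarith
  have hdisj : Pairwise (Function.onFun Disjoint s) := by
    intro m n hmn
    refine Set.disjoint_left.2 fun x hx hx' => hmn ?_
    ext i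
    have h1 := hx i
    have h2 := hx' i
    simp only [Pi.add_apply, Set.mem_Ioc] at h1 h2
    have h3 : (m i : ℝ) < n i + 1 := by linarith
    have h4 : (n i : ℝ) < m i + 1 := by linarith
    norm_cast at h3 h4
    lia
  rw [← setIntegral_univ, ← hU, integral_iUnion hs hdisj hg.integrableOn]
  refine tsum_congr fun n => ?_
  have := (measurePreserving_add_right (volume : Measure (ι → ℝ))
    (fun i => (-n i : ℝ))).setIntegral_preimage_emb
      (MeasurableEquiv.addRight (fun i => (-n i : ℝ))).measurableEmbedding
      (fun x => g (x + fun i => (n i : ℝ))) D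
  rw [← this]
  refine setIntegral_congr_fun (hs n) fun x _ => ?_
  have : ((x + fun i => (-n i : ℝ)) + fun i => (n i : ℝ)) = x := by
    ext i
    simp
  simp only [this]

theorem tsum_intCast_eq_tsum_fourier {g : (ι → ℝ) → ℂ} (hc : Continuous g) (hi : Integrable g)
    (hu : ∀ R : ℝ, ∃ u : (ι → ℤ) → ℝ, Summable u ∧
      ∀ n x, ‖x‖ ≤ R → ‖g (x + fun i => (n i : ℝ))‖ ≤ u n)
    (hs : Summable fun n : ι → ℤ => ∫ x : ι → ℝ, cexp (2 * π * I * ∑ i, (-n i : ℤ) * x i) * g x) :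
    ∑' n : ι → ℤ, g (fun i => n i) =
      ∑' n : ι → ℤ, ∫ x : ι → ℝ, cexp (2 * π * I * ∑ i, (-n i : ℤ) * x i) * g x := by
  let P : (ι → ℝ) → ℂ := fun x => ∑' n : ι → ℤ, g (x + fun i => (n i : ℝ))
  have hPc : Continuous P := by
    rw [continuous_iff_continuousAt]
    intro x
    obtain ⟨u, hu1, hu2⟩ := hu (‖x‖ + 1)
    have : ContinuousOn P (Metric.ball x 1) := by
      refine continuousOn_tsum (fun n => (hc.comp (by fun_prop)).continuousOn) hu1 fun n y hy => ?_
      refine hu2 n y ?_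
      have := norm_sub_norm_le y x
      rw [Metric.mem_ball, dist_eq_norm] at hy
      linarith
    exact this.continuousAt (Metric.ball_mem_nhds x one_pos)
  have hper (x y : ι → ℝ) (h : (fun i => (x i : UnitAddCircle)) = fun i => (y i : UnitAddCircle)) :
      P x = P y := by
    have h1 (i : ι) : ∃ n : ℤ, y i = x i + n := by
      have h2 : ((y i - x i : ℝ) : UnitAddCircle) = 0 := by
        rw [AddCircle.coe_sub, sub_eq_zero]
        exact (congrFun h i).symm
      obtain ⟨n, hn⟩ := AddCircle.coe_eq_zero_iff (1 : ℝ) |>.1 h2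
      exact ⟨n, by simp at hn; linarith⟩
    choose m hm using h1
    simp only [P]
    rw [← (Equiv.addRight m).tsum_eq]
    refine tsum_congr fun n => congrArg g ?_
    ext i
    simp [hm]
    ring
  let q : (ι → ℝ) → UnitAddTorus ι := fun x i => (x i : UnitAddCircle)
  have hq : IsOpenQuotientMap q := isOpenQuotientMap_coe_unitAddTorus
  let F₀ : UnitAddTorus ι → ℂ := fun t => P (Function.surjInv hq.surjective t)
  have hF₀ (x : ι → ℝ) : F₀ (q x) = P x := hper _ _ (Function.surjInv_eq hq.surjective (q x))
  have hF₀c : Continuous F₀ := by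
    rw [hq.isQuotientMap.continuous_iff]
    convert hPc using 1
    exact funext hF₀
  let F : C(UnitAddTorus ι, ℂ) := ⟨F₀, hF₀c⟩
  have hnorm (n : ι → ℤ) (x : ι → ℝ) : ‖cexp (2 * π * I * ∑ i, (-n i : ℤ) * x i)‖ = 1 := by
    rw [← norm_exp_ofReal_mul_I (2 * π * ∑ i, (-n i : ℤ) * x i)]
    congr 2
    push_cast
    ring
  have hcoeff (n : ι → ℤ) :
      mFourierCoeff F n = ∫ x : ι → ℝ, cexp (2 * π * I * ∑ i, (-n i : ℤ) * x i) * g x := by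
    rw [mFourierCoeff_eq_integral _ n 0, integral_eq_tsum_unitCube (hi.bdd_mul (c := 1)
      (Continuous.aestronglyMeasurable (by fun_prop)) (.of_forall fun x => (hnorm n x).le))]
    set D : Set (ι → ℝ) := {x : ι → ℝ | ∀ i, x i ∈ Set.Ioc (0 : ℝ) (0 + 1)} with hD
    have hDm : MeasurableSet D := MeasurableSet.univ_pi' fun i => measurableSet_Ioc
    have hDsub : D ⊆ Metric.closedBall 0 1 := fun x hx => by
      rw [mem_closedBall_zero_iff, pi_norm_le_iff_of_nonneg zero_le_one]
      intro i
      have := hx i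
      rw [Set.mem_Ioc] at this
      rw [Real.norm_eq_abs, abs_le]
      constructor <;> linarith
    have hDfin : volume D < ⊤ :=
      (measure_mono hDsub).trans_lt (isCompact_closedBall _ _).measure_lt_top
    obtain ⟨u, hu1, hu2⟩ := hu 1
    have hbound (m : ι → ℤ) (x : ι → ℝ) (hx : x ∈ D) :
        ‖cexp (2 * π * I * ∑ i, (-n i : ℤ) * (x + fun i => (m i : ℝ)) i) *
          g (x + fun i => (m i : ℝ))‖ ≤ u m := by
      rw [norm_mul, hnorm, one_mul]
      exact hu2 m x (mem_closedBall_zero_iff.1 (hDsub hx))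
    have hint (m : ι → ℤ) : IntegrableOn (fun x : ι → ℝ =>
        cexp (2 * π * I * ∑ i, (-n i : ℤ) * (x + fun i => (m i : ℝ)) i) *
          g (x + fun i => (m i : ℝ))) D :=
      IntegrableOn.of_bound hDfin (Continuous.aestronglyMeasurable (by fun_prop)) (u m)
        ((ae_restrict_iff' hDm).2 (.of_forall (hbound m)))
    rw [integral_tsum_of_summable_integral_norm hint]
    · refine setIntegral_congr_fun hDm fun x _ => ?_
      change mFourier (-n) (q x) • F₀ (q x) = _
      rw [hF₀, mFourier_apply_coe, smul_eq_mul, ← tsum_mul_left]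
      refine tsum_congr fun m => ?_
      congr 1
      refine Complex.exp_eq_exp_iff_exists_int.2 ⟨∑ i, n i * m i, ?_⟩
      simp only [Pi.neg_apply, Pi.add_apply]
      push_cast
      simp only [neg_mul, mul_add, Finset.sum_neg_distrib, Finset.sum_add_distrib]
      ring
    · refine Summable.of_nonneg_of_le (fun m => integral_nonneg fun _ => norm_nonneg _)
        (fun m => ?_) (hu1.mul_right (volume.real D))
      refine (Real.le_norm_self _).trans
        (norm_setIntegral_le_of_norm_le_const hDfin fun x hx => ?_)
      rw [norm_norm]
      exact hbound m x hx
  have hsum : Summable (mFourierCoeff F) := by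
    rw [funext hcoeff]; exact hs
  have := (hasSum_mFourier_series_apply_of_summable hsum (q 0)).tsum_eq
  rw [show F (q 0) = P 0 from hF₀ 0] at this
  simp only [P, zero_add] at this
  rw [← this]
  refine tsum_congr fun n => ?_
  rw [hcoeff, mFourier_apply_coe]
  simp

end PoissonPi

section PoissonLattice

open Complex UnitAddTorus
open scoped Real

variable {E : Type*} [NormedAddCommGroup E] [InnerProductSpace ℝ E] [FiniteDimensional ℝ E]
  {L : Submodule ℤ E} [DiscreteTopology L] [IsZLattice ℝ L]

theorem bijective_inner_basis_of_selfDual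
    (hdual : ∀ y : E, y ∈ L ↔ ∀ x ∈ L, ∃ k : ℤ, ⟪x, y⟫ = (k : ℝ))
    {κ : Type*} [Fintype κ] (b : Module.Basis κ ℤ L) :
    ∃ e : L ≃ (κ → ℤ), ∀ (y : L) (i : κ), ((e y i : ℤ) : ℝ) = ⟪(b i : E), (y : E)⟫ := by
  have h (y : L) (i : κ) : ∃ k : ℤ, (k : ℝ) = ⟪(b i : E), (y : E)⟫ := by
    obtain ⟨k, hk⟩ := (hdual y).1 y.2 (b i) (b i).2
    exact ⟨k, hk.symm⟩
  choose e he using h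
  let bR := b.ofZLatticeBasis ℝ L
  refine ⟨Equiv.ofBijective e ⟨fun y z hyz => ?_, fun n => ?_⟩, he⟩
  · refine Subtype.ext (InnerProductSpace.ext_inner_left_basis (𝕜 := ℝ) bR fun i => ?_)
    rw [Module.Basis.ofZLatticeBasis_apply, ← he, ← he, hyz]
  · let l : E →L[ℝ] ℝ := (bR.constr ℝ fun i => (n i : ℝ)).toContinuousLinearMap
    let y : E := (InnerProductSpace.toDual ℝ E).symm l
    have hy (i : κ) : ⟪(b i : E), y⟫ = n i := by
      rw [real_inner_comm, InnerProductSpace.toDual_symm_apply,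
        ← Module.Basis.ofZLatticeBasis_apply ℝ L b i]
      exact bR.constr_basis ℝ _ i
    have hyL : y ∈ L := by
      refine (hdual y).2 fun x hx => ⟨∑ i, b.repr ⟨x, hx⟩ i * n i, ?_⟩
      have : x = ∑ i, (b.repr ⟨x, hx⟩ i) • (b i : E) := by
        have := congrArg L.subtype (b.sum_repr ⟨x, hx⟩)
        rw [map_sum] at this
        exact this.symm
      conv_lhs => rw [this]
      rw [sum_inner]
      push_cast
      refine Finset.sum_congr rfl fun i _ => ?_
      rw [← Int.cast_smul_eq_zsmul ℝ, real_inner_smul_left, hy]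
    refine ⟨⟨y, hyL⟩, funext fun i => ?_⟩
    exact_mod_cast (he ⟨y, hyL⟩ i).trans (hy i)

variable [MeasurableSpace E] [BorelSpace E]

theorem exists_tsum_lattice_eq_mul_tsum_fourier
    (hdual : ∀ y : E, y ∈ L ↔ ∀ x ∈ L, ∃ k : ℤ, ⟪x, y⟫ = (k : ℝ)) :
    ∃ c : ℝ, ∀ f : E → ℂ, Continuous f → Integrable f →
      (∀ R : ℝ, ∃ u : L → ℝ, Summable u ∧ ∀ (x : L) (v : E), ‖v‖ ≤ R → ‖f (v + x)‖ ≤ u x) →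
      (Summable fun y : L => ∫ v, cexp (-2 * π * I * ⟪v, (y : E)⟫) * f v) →
      ∑' x : L, f x = c * ∑' y : L, ∫ v, cexp (-2 * π * I * ⟪v, (y : E)⟫) * f v := by
  obtain ⟨κ, _, ⟨b⟩⟩ : ∃ (κ : Type _) (_ : Fintype κ), Nonempty (Module.Basis κ ℤ L) :=
    ⟨_, inferInstance, ⟨Module.Free.chooseBasis ℤ L⟩⟩
  obtain ⟨e, he⟩ := bijective_inner_basis_of_selfDual hdual b
  let bR := b.ofZLatticeBasis ℝ L
  let φ : (κ → ℝ) ≃L[ℝ] E := bR.equivFunL.symm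
  have hφm : MeasurableEmbedding φ := φ.toHomeomorph.measurableEmbedding
  obtain ⟨c, hc⟩ : ∃ c : NNReal, (volume : Measure (κ → ℝ)).map φ = c • (volume : Measure E) :=
    ⟨_, Measure.isAddLeftInvariant_eq_smul _ _⟩
  refine ⟨c, fun f hf hfi hfu hfs => ?_⟩
  have hint (h : E → ℂ) : ∫ t, h (φ t) = c * ∫ v, h v := by
    rw [← hφm.integral_map h]
    rw [hc, integral_smul_nnreal_measure]
    rfl
  have hφL (n : κ → ℤ) : φ (fun i => (n i : ℝ)) = (b.equivFun.symm n : L) := by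
    rw [b.equivFun_symm_apply]
    refine (bR.equivFun_symm_apply _).trans ?_
    simp [bR, ← Int.cast_smul_eq_zsmul ℝ]
  have hφy (t : κ → ℝ) (y : L) : ⟪φ t, (y : E)⟫ = ∑ i, e y i * t i := by
    rw [show φ t = ∑ i, t i • bR i from bR.equivFun_symm_apply t, sum_inner]
    refine Finset.sum_congr rfl fun i _ => ?_
    rw [real_inner_smul_left, Module.Basis.ofZLatticeBasis_apply, he, mul_comm]
  have hfour (y : L) : ∫ t : κ → ℝ, cexp (2 * π * I * ∑ i, (-(e y) i : ℤ) * t i) * f (φ t) =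
      c * ∫ v, cexp (-2 * π * I * ⟪v, (y : E)⟫) * f v := by
    rw [← hint fun v => cexp (-2 * π * I * ⟪v, (y : E)⟫) * f v]
    refine integral_congr_ae (.of_forall fun t => ?_)
    simp only [hφy]
    push_cast
    simp
  have key := tsum_intCast_eq_tsum_fourier (g := f ∘ φ) (hf.comp φ.continuous) ?_ ?_ ?_
  · simp only [Function.comp_apply, hφL] at key
    rw [← b.equivFun.symm.toEquiv.tsum_eq (fun x : L => f x)]
    refine key.trans ?_
    rw [← e.tsum_eq, ← tsum_mul_left]
    exact tsum_congr hfour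
  · rw [← hφm.integrable_map_iff]
    rw [hc]
    exact hfi.smul_measure_nnreal
  · intro R
    obtain ⟨u, hu1, hu2⟩ := hfu (‖(φ : (κ → ℝ) →L[ℝ] E)‖ * R)
    refine ⟨u ∘ b.equivFun.symm, (b.equivFun.symm.toEquiv.summable_iff).2 hu1, fun n t ht => ?_⟩
    rw [Function.comp_apply, map_add, hφL]
    refine hu2 _ _ (((φ : (κ → ℝ) →L[ℝ] E).le_opNorm t).trans ?_)
    gcongr
  · rw [← e.summable_iff]
    simp only [Function.comp_def, hfour]
    exact hfs.mul_left _

end PoissonLattice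

section GaussianSums

open Complex
open scoped Real

theorem exists_pow_mul_exp_neg_le {α : ℝ} (hα : 0 < α) (β : ℝ) (d : ℕ) :
    ∃ C, ∀ r : ℝ, 0 ≤ r → r ^ d * rexp (-α * r ^ 2 + β * r) ≤ C := by
  have h : Filter.Tendsto (fun r : ℝ => r ^ d * rexp (-α * r ^ 2 + β * r)) Filter.atTop (nhds 0) := by
    refine squeeze_zero' (Filter.eventually_atTop.2 ⟨0, fun r hr => by positivity⟩) ?_
      (Real.tendsto_pow_mul_exp_neg_atTop_nhds_zero d)
    filter_upwards [Filter.eventually_ge_atTop 0, Filter.eventually_ge_atTop ((β + 1) / α)]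
      with r hr hr'
    gcongr
    rw [div_le_iff₀ hα] at hr'
    nlinarith
  obtain ⟨R, hR⟩ := Filter.eventually_atTop.1 (h.eventually_le_const one_pos)
  obtain ⟨C, hC⟩ := (isCompact_Icc (a := (0 : ℝ)) (b := R)).exists_bound_of_continuousOn
    (f := fun r : ℝ => r ^ d * rexp (-α * r ^ 2 + β * r)) (by fun_prop)
  refine ⟨max C 1, fun r hr => ?_⟩
  rcases le_total r R with h1 | h1
  · exact (Real.le_norm_self _).trans ((hC r ⟨hr, h1⟩).trans (le_max_left _ _))
  · exact (hR r h1).trans (le_max_right _ _)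

theorem summable_norm_pow_mul_exp {E : Type*} [NormedAddCommGroup E] [NormedSpace ℝ E]
    [FiniteDimensional ℝ E] (L : Submodule ℤ E) [DiscreteTopology L] {α : ℝ} (hα : 0 < α) (β : ℝ)
    (d : ℕ) : Summable fun x : L => ‖x‖ ^ d * rexp (-α * ‖x‖ ^ 2 + β * ‖x‖) := by
  set n := Module.finrank ℤ L + 1
  obtain ⟨C, hC⟩ := exists_pow_mul_exp_neg_le hα β (d + n)
  refine Summable.of_norm_bounded_eventually (g := fun x : L => C * ‖x‖⁻¹ ^ n)
    ((ZLattice.summable_norm_pow_inv L n (Nat.lt_succ_self _)).mul_left C) ?_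
  refine (Set.finite_singleton (0 : L)).subset fun x hx => ?_
  by_contra h0
  refine hx ?_
  have hx0 : 0 < ‖x‖ := norm_pos_iff.2 h0
  rw [Set.mem_ofPred_eq, Real.norm_of_nonneg (by positivity), inv_pow, ← div_eq_mul_inv, le_div_iff₀ (by positivity)]
  refine le_trans (le_of_eq ?_) (hC ‖x‖ hx0.le)
  ring

variable {ι : Type*} [Fintype ι] (ℓ : EuclideanSpace ℝ ι →L[ℝ] ℂ)

theorem EuclideanSpace.apply_eq_sum_single [DecidableEq ι] (v : EuclideanSpace ℝ ι) :
    ℓ v = ∑ i, v i * ℓ (EuclideanSpace.single i 1) := by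
  conv_lhs => rw [← (EuclideanSpace.basisFun ι ℝ).sum_repr v]
  simp [map_sum]

theorem gaussian_exponent_eq [DecidableEq ι] (b s t : ℂ) (y : EuclideanSpace ℝ ι) (v : ι → ℝ) :
    -b * (‖(WithLp.toLp 2 v : EuclideanSpace ℝ ι)‖ : ℂ) ^ 2 +
      (s * ℓ (WithLp.toLp 2 v) + t * ⟪WithLp.toLp 2 v, y⟫) =
    -b * ∑ i, (v i : ℂ) ^ 2 + ∑ i, (s * ℓ (EuclideanSpace.single i 1) + t * y i) * v i := by
  congr 1
  · rw [← ofReal_pow, EuclideanSpace.real_norm_sq_eq]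
    simp
  · rw [EuclideanSpace.apply_eq_sum_single, PiLp.inner_apply, Finset.mul_sum, ofReal_sum,
      Finset.mul_sum, ← Finset.sum_add_distrib]
    refine Finset.sum_congr rfl fun i _ => ?_
    simp
    ring

theorem integrable_gaussian {b : ℂ} (hb : 0 < b.re) (s t : ℂ) (y : EuclideanSpace ℝ ι) :
    Integrable fun v : EuclideanSpace ℝ ι =>
      cexp (-b * (‖v‖ : ℂ) ^ 2 + (s * ℓ v + t * ⟪v, y⟫)) := by
  classical
  rw [← (PiLp.volume_preserving_toLp ι).integrable_comp_emb
    (MeasurableEquiv.toLp 2 _).measurableEmbedding]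
  simp only [Function.comp_def, gaussian_exponent_eq]
  exact GaussianFourier.integrable_cexp_neg_mul_sum_add hb _

theorem integral_gaussian_isotropic [DecidableEq ι] {b : ℂ} (hb : 0 < b.re)
    (hℓ : ∑ i, ℓ (EuclideanSpace.single i 1) ^ 2 = 0) (s t : ℂ) (y : EuclideanSpace ℝ ι) :
    ∫ v : EuclideanSpace ℝ ι, cexp (-b * (‖v‖ : ℂ) ^ 2 + (s * ℓ v + t * ⟪v, y⟫)) =
      (π / b) ^ (Fintype.card ι / 2 : ℂ) *
        cexp ((2 * s * t * ℓ y + t ^ 2 * (‖y‖ : ℂ) ^ 2) / (4 * b)) := by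
  rw [← (PiLp.volume_preserving_toLp ι).integral_comp
    (MeasurableEquiv.toLp 2 _).measurableEmbedding]
  simp only [gaussian_exponent_eq]
  rw [GaussianFourier.integral_cexp_neg_mul_sum_add hb]
  congr 3
  rw [EuclideanSpace.apply_eq_sum_single, ← ofReal_pow, EuclideanSpace.real_norm_sq_eq, ofReal_sum,
    Finset.mul_sum, Finset.mul_sum, ← add_zero (∑ i, _), ← mul_zero (-s ^ 2), ← hℓ, Finset.mul_sum,
    ← Finset.sum_add_distrib, ← Finset.sum_add_distrib]
  refine Finset.sum_congr rfl fun i _ => ?_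
  push_cast
  ring

end GaussianSums

section LatticeTheta

open Complex
open scoped Real

variable {E : Type*} [NormedAddCommGroup E] [InnerProductSpace ℝ E] [FiniteDimensional ℝ E]
  (L : Submodule ℤ E) (ℓ : E →L[ℝ] ℂ)

/-- The term at `x` of the theta series with the weight `ℓ ^ d`. -/
noncomputable def thetaTerm (d : ℕ) (τ w : ℂ) (x : E) : ℂ :=
  ℓ x ^ d * cexp (π * I * τ * (‖x‖ : ℂ) ^ 2 + 2 * π * I * w * ℓ x)

/-- The theta series of the lattice `L`, weighted by the `d`-th power of a linear form `ℓ`,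
with an elliptic variable `w`. -/
noncomputable def latticeTheta (d : ℕ) (τ w : ℂ) : ℂ := ∑' x : L, thetaTerm ℓ d τ w x

omit [FiniteDimensional ℝ E] in
theorem norm_thetaTerm_le (d : ℕ) (τ : ℂ) {w : ℂ} {W : ℝ} (hw : ‖w‖ ≤ W) (x : E) :
    ‖thetaTerm ℓ d τ w x‖ ≤
      ‖ℓ‖ ^ d * (‖x‖ ^ d * rexp (-(π * τ.im) * ‖x‖ ^ 2 + (2 * π * W * ‖ℓ‖) * ‖x‖)) := by
  rw [thetaTerm, norm_mul, norm_pow, Complex.norm_exp, ← mul_assoc, ← mul_pow]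
  have h1 : (2 * π * I * w * ℓ x).re ≤ 2 * π * W * ‖ℓ‖ * ‖x‖ := by
    refine (Complex.re_le_norm _).trans ?_
    have := ℓ.le_opNorm x
    have hW : 0 ≤ W := (norm_nonneg _).trans hw
    calc ‖2 * π * I * w * ℓ x‖ = 2 * π * ‖w‖ * ‖ℓ x‖ := by
          simp [abs_of_pos Real.pi_pos]
      _ ≤ 2 * π * W * (‖ℓ‖ * ‖x‖) := by gcongr
      _ = _ := by ring
  have h2 : (π * I * τ * (‖x‖ : ℂ) ^ 2).re = -(π * τ.im) * ‖x‖ ^ 2 := by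
    rw [← ofReal_pow, re_mul_ofReal]
    simp
  rw [add_re, h2]
  gcongr
  exact ℓ.le_opNorm x

variable [DiscreteTopology L]

theorem summable_thetaTerm (d : ℕ) {τ : ℂ} (hτ : 0 < τ.im) (w : ℂ) :
    Summable fun x : L => thetaTerm ℓ d τ w x :=
  .of_norm_bounded ((summable_norm_pow_mul_exp L (mul_pos Real.pi_pos hτ) _ d).mul_left _)
    fun x => norm_thetaTerm_le ℓ d τ le_rfl (x : E)

theorem hasDerivAt_latticeTheta (d : ℕ) {τ : ℂ} (hτ : 0 < τ.im) (w : ℂ) :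
    HasDerivAt (latticeTheta L ℓ d τ) (2 * π * I * latticeTheta L ℓ (d + 1) τ w) w := by
  have hd (x : E) (v : ℂ) : HasDerivAt (fun v => thetaTerm ℓ d τ v x)
      (2 * π * I * thetaTerm ℓ (d + 1) τ v x) v := by
    have h := ((((hasDerivAt_id v).const_mul (2 * π * I)).mul_const (ℓ x)).const_add
      (π * I * τ * (‖x‖ : ℂ) ^ 2)).cexp.const_mul (ℓ x ^ d)
    refine h.congr_deriv ?_
    simp only [thetaTerm, id]
    ring
  unfold latticeTheta
  rw [← tsum_mul_left]
  have hS := summable_norm_pow_mul_exp L (mul_pos Real.pi_pos hτ) (2 * π * (‖w‖ + 1) * ‖ℓ‖) (d + 1)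
  refine hasDerivAt_tsum_of_isPreconnected (t := Metric.ball w 1)
    ((hS.mul_left (‖ℓ‖ ^ (d + 1))).mul_left (2 * π)) Metric.isOpen_ball
    (convex_ball w 1).isPreconnected (fun x v _ => hd x v) (fun x v hv => ?_)
    (Metric.mem_ball_self one_pos) (summable_thetaTerm L ℓ d hτ w) (Metric.mem_ball_self one_pos)
  rw [norm_mul, show ‖(2 * π * I : ℂ)‖ = 2 * π by simp [abs_of_pos Real.pi_pos]]
  gcongr
  refine norm_thetaTerm_le ℓ (d + 1) τ ?_ (x : E)
  rw [Metric.mem_ball, dist_eq_norm] at hv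
  linarith [norm_sub_norm_le v w]

theorem thetaTerm_zero_norm_add_le {τ : ℂ} (hτ : 0 < τ.im) (w : ℂ) (R : ℝ) :
    ∃ u : L → ℝ, Summable u ∧ ∀ (x : L) (v : E), ‖v‖ ≤ R → ‖thetaTerm ℓ 0 τ w (v + x)‖ ≤ u x := by
  have hπ : 0 < π * τ.im := mul_pos Real.pi_pos hτ
  refine ⟨_, (summable_norm_pow_mul_exp L (half_pos hπ) (2 * π * ‖w‖ * ‖ℓ‖) 0).mul_left
    (rexp (π * τ.im * R ^ 2 + 2 * π * ‖w‖ * ‖ℓ‖ * R)), fun x v hv => ?_⟩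
  refine (norm_thetaTerm_le ℓ 0 τ le_rfl _).trans ?_
  simp only [pow_zero, one_mul, ← Real.exp_add]
  refine Real.exp_le_exp.2 ?_
  have h1 : ‖v + x‖ ≤ ‖x‖ + R := (norm_add_le _ _).trans (by rw [add_comm]; gcongr; rfl)
  have h2 : ‖x‖ ^ 2 / 2 - R ^ 2 ≤ ‖v + x‖ ^ 2 := by
    have : ‖x‖ ≤ ‖v + x‖ + R := by
      calc ‖x‖ = ‖(v + x) - v‖ := by simp
        _ ≤ _ := (norm_sub_le _ _).trans (by gcongr)
    have := pow_le_pow_left₀ (norm_nonneg x) this 2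
    nlinarith [sq_nonneg (‖v + x‖ - R)]
  have h3 : 2 * π * ‖w‖ * ‖ℓ‖ * ‖v + x‖ ≤ 2 * π * ‖w‖ * ‖ℓ‖ * (‖x‖ + R) := by gcongr
  have h4 := mul_le_mul_of_nonneg_left h2 hπ.le
  linarith

end LatticeTheta

section Inversion

open Complex
open scoped Real

variable {ι : Type*} [Fintype ι] [DecidableEq ι] (L : Submodule ℤ (EuclideanSpace ℝ ι))
  [DiscreteTopology L] [IsZLattice ℝ L] (ℓ : EuclideanSpace ℝ ι →L[ℝ] ℂ)

theorem neg_inv_im_pos {τ : ℂ} (hτ : 0 < τ.im) : 0 < (-1 / τ).im := by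
  have := (UpperHalfPlane.mk τ hτ).im_inv_neg_coe_pos
  rwa [UpperHalfPlane.coe_mk, inv_neg, ← one_div, ← neg_div] at this

theorem fourier_thetaTerm (hℓ : ∑ i, ℓ (EuclideanSpace.single i 1) ^ 2 = 0) {τ : ℂ}
    (hτ : 0 < τ.im) (w : ℂ) (y : EuclideanSpace ℝ ι) :
    ∫ v, cexp (-2 * π * I * ⟪v, y⟫) * thetaTerm ℓ 0 τ w v =
      (π / (-(π * I * τ))) ^ (Fintype.card ι / 2 : ℂ) * thetaTerm ℓ 0 (-1 / τ) (w / τ) y := by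
  have hb : 0 < (-(π * I * τ)).re := by
    simpa using mul_pos Real.pi_pos hτ
  have hτ0 : τ ≠ 0 := by rintro rfl; simp at hτ
  rw [thetaTerm, pow_zero, one_mul]
  convert integral_gaussian_isotropic ℓ hb hℓ (2 * π * I * w) (-2 * π * I) y using 3 with v
  · rw [thetaTerm, pow_zero, one_mul, ← Complex.exp_add]
    congr 1
    ring
  · have := Real.pi_ne_zero
    field_simp
    ring

theorem latticeTheta_inversion_const
    (hdual : ∀ y, y ∈ L ↔ ∀ x ∈ L, ∃ k : ℤ, ⟪x, y⟫ = (k : ℝ)) :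
    ∃ c : ℝ, ∀ (ℓ : EuclideanSpace ℝ ι →L[ℝ] ℂ), ∑ i, ℓ (EuclideanSpace.single i 1) ^ 2 = 0 →
      ∀ {τ : ℂ}, 0 < τ.im → ∀ w, latticeTheta L ℓ 0 τ w =
        c * ((π / (-(π * I * τ))) ^ (Fintype.card ι / 2 : ℂ) *
          latticeTheta L ℓ 0 (-1 / τ) (w / τ)) := by
  obtain ⟨c, hc⟩ := exists_tsum_lattice_eq_mul_tsum_fourier hdual
  refine ⟨c, fun ℓ hℓ τ hτ w => ?_⟩
  have hb : 0 < (-(π * I * τ)).re := by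
    simpa using mul_pos Real.pi_pos hτ
  have h := hc (thetaTerm ℓ 0 τ w) (by unfold thetaTerm; fun_prop) ?_
    (thetaTerm_zero_norm_add_le L ℓ hτ w) ?_
  · rw [latticeTheta, h, latticeTheta, ← tsum_mul_left]
    simp only [fourier_thetaTerm ℓ hℓ hτ, tsum_mul_left]
  · refine (integrable_gaussian ℓ hb (2 * π * I * w) 0 0).congr (.of_forall fun v => ?_)
    simp only [thetaTerm, pow_zero, one_mul]
    congr 1
    ring
  · simp only [fourier_thetaTerm ℓ hℓ hτ]
    exact (summable_thetaTerm L ℓ 0 (neg_inv_im_pos hτ) _).mul_left _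

theorem latticeTheta_zero_inversion
    (hdual : ∀ y, y ∈ L ↔ ∀ x ∈ L, ∃ k : ℤ, ⟪x, y⟫ = (k : ℝ))
    (hℓ : ∑ i, ℓ (EuclideanSpace.single i 1) ^ 2 = 0) {τ : ℂ} (hτ : 0 < τ.im) (w : ℂ) :
    latticeTheta L ℓ 0 τ w = (π / (-(π * I * τ))) ^ (Fintype.card ι / 2 : ℂ) *
      latticeTheta L ℓ 0 (-1 / τ) (w / τ) := by
  obtain ⟨c, hc⟩ := latticeTheta_inversion_const L hdual
  suffices c = 1 by simpa [this] using hc ℓ hℓ hτ w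
  have h := hc 0 (by simp) (τ := I) (by simp) 0
  have hπ : (π : ℂ) ≠ 0 := by exact_mod_cast Real.pi_ne_zero
  have h1 : (π : ℂ) / (-(π * I * I)) = 1 := by
    rw [mul_assoc, I_mul_I]
    field_simp
  have h2 : (-1 : ℂ) / I = I := by
    rw [div_I]; ring
  rw [h1, h2, zero_div, one_cpow, one_mul] at h
  have h3 (x : L) : thetaTerm (0 : EuclideanSpace ℝ ι →L[ℝ] ℂ) 0 I 0 x =
      (rexp (-π * ‖x‖ ^ 2) : ℝ) := by
    rw [thetaTerm]
    push_cast
    simp only [pow_zero, one_mul, mul_zero, zero_mul, add_zero, mul_assoc]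
    rw [← mul_assoc I I, I_mul_I, Submodule.coe_norm]
    congr 1
    ring
  have h4 : latticeTheta L 0 0 I 0 ≠ 0 := by
    rw [latticeTheta]
    simp only [h3]
    rw [← ofReal_tsum, ofReal_ne_zero]
    refine ne_of_gt (Summable.tsum_pos ?_ (fun _ => by positivity) 0 (by positivity))
    have := summable_norm_pow_mul_exp L Real.pi_pos 0 0
    simpa using this
  have h5 : (c : ℂ) = 1 := mul_right_cancel₀ h4 (by rw [← h, one_mul])
  exact_mod_cast h5

theorem latticeTheta_inversion
    (hdual : ∀ y, y ∈ L ↔ ∀ x ∈ L, ∃ k : ℤ, ⟪x, y⟫ = (k : ℝ))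
    (hℓ : ∑ i, ℓ (EuclideanSpace.single i 1) ^ 2 = 0) (d : ℕ) {τ : ℂ} (hτ : 0 < τ.im) (w : ℂ) :
    latticeTheta L ℓ d τ w = (π / (-(π * I * τ))) ^ (Fintype.card ι / 2 : ℂ) / τ ^ d *
      latticeTheta L ℓ d (-1 / τ) (w / τ) := by
  induction d generalizing w with
  | zero => simpa using latticeTheta_zero_inversion L ℓ hdual hℓ hτ w
  | succ d ih =>
    set C : ℂ := (π / (-(π * I * τ))) ^ (Fintype.card ι / 2 : ℂ)
    have h1 := hasDerivAt_latticeTheta L ℓ d hτ w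
    have h2 := ((hasDerivAt_latticeTheta L ℓ d (neg_inv_im_pos hτ) (w / τ)).comp w
      ((hasDerivAt_id w).div_const τ)).const_mul (C / τ ^ d)
    have h3 := h1.unique (h2.congr_of_eventuallyEq (.of_forall ih))
    have hπ : (2 * π * I : ℂ) ≠ 0 := two_pi_I_ne_zero
    refine mul_left_cancel₀ hπ (h3.trans ?_)
    ring

end Inversion

section LeechTheta

open Complex
open scoped Real

open UpperHalfPlane hiding I
open ModularForm SlashInvariantForm ModularGroup
open scoped MatrixGroups

variable {L : Submodule ℤ (EuclideanSpace ℝ (Fin 24))} [DiscreteTopology L] [IsZLattice ℝ L]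

omit [DiscreteTopology L] [IsZLattice ℝ L] in
theorem exists_nat_norm_sq_eq (heven : ∀ x ∈ L, ∃ k : ℤ, ⟪x, x⟫ = 2 * (k : ℝ)) :
    ∃ g : L → ℕ, ∀ x : L, ‖(x : E₂₄)‖ ^ 2 = 2 * (g x : ℝ) := by
  have h (x : L) : ∃ n : ℕ, ‖(x : E₂₄)‖ ^ 2 = 2 * (n : ℝ) := by
    obtain ⟨k, hk⟩ := heven x x.2
    rw [real_inner_self_eq_norm_sq] at hk
    have hk0 : 0 ≤ k := by
      have : (0 : ℝ) ≤ k := by nlinarith [sq_nonneg ‖(x : E₂₄)‖]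
      exact_mod_cast this
    lift k to ℕ using hk0
    exact ⟨k, by simpa using hk⟩
  exact ⟨fun x => (h x).choose, fun x => (h x).choose_spec⟩

theorem differentiableOn_latticeTheta {E : Type*} [NormedAddCommGroup E] [InnerProductSpace ℝ E]
    [FiniteDimensional ℝ E] (L : Submodule ℤ E) [DiscreteTopology L] (ℓ : E →L[ℝ] ℂ) (d : ℕ) :
    DifferentiableOn ℂ (fun τ => latticeTheta L ℓ d τ 0) {τ | 0 < τ.im} := by
  intro τ hτ
  rw [Set.mem_ofPred_eq] at hτ
  have hU : IsOpen {σ : ℂ | τ.im / 2 < σ.im} := isOpen_lt continuous_const continuous_im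
  have hmem : τ ∈ {σ : ℂ | τ.im / 2 < σ.im} := half_lt_self hτ
  have hS := (summable_norm_pow_mul_exp L (mul_pos Real.pi_pos (half_pos hτ)) 0 d).mul_left (‖ℓ‖ ^ d)
  refine ((differentiableOn_tsum_of_summable_norm hS (fun x => ?_) hU fun x σ hσ => ?_).differentiableAt
    (hU.mem_nhds hmem)).differentiableWithinAt
  · unfold thetaTerm
    fun_prop
  · refine (norm_thetaTerm_le ℓ d σ (W := 0) (by simp) (x : E)).trans ?_
    rw [Set.mem_ofPred_eq] at hσ
    simp only [mul_zero, zero_mul, Submodule.coe_norm]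
    gcongr

omit [DiscreteTopology L] [IsZLattice ℝ L] in
theorem thetaTerm_zero_eq (g : L → ℕ) (hg : ∀ x : L, ‖(x : E₂₄)‖ ^ 2 = 2 * (g x : ℝ))
    (ℓ : E₂₄ →L[ℝ] ℂ) (d : ℕ) (τ : ℂ) (x : L) :
    thetaTerm ℓ d τ 0 x = ℓ x ^ d * Function.Periodic.qParam 1 τ ^ g x := by
  rw [thetaTerm, ← ofReal_pow, hg, Function.Periodic.qParam, ← Complex.exp_nat_mul]
  congr 2
  push_cast
  ring

omit [IsZLattice ℝ L] in
theorem hasSum_latticeTheta (g : L → ℕ) (hg : ∀ x : L, ‖(x : E₂₄)‖ ^ 2 = 2 * (g x : ℝ))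
    (ℓ : E₂₄ →L[ℝ] ℂ) (d : ℕ) (τ : ℍ) :
    HasSum (fun m : ℕ => (∑' x : {x : L // g x = m}, ℓ x.1 ^ d) •
      Function.Periodic.qParam 1 τ ^ m) (latticeTheta L ℓ d τ 0) := by
  have h := (summable_thetaTerm L ℓ d τ.im_pos 0)
  have h1 := ((Equiv.sigmaFiberEquiv g).hasSum_iff.2 h.hasSum)
  have h2 := h1.sigma fun m => ((h1.summable.sigma_factor m).hasSum)
  rw [latticeTheta]
  convert h2 using 2 with m
  rw [smul_eq_mul, ← tsum_mul_right]
  refine tsum_congr fun x => ?_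
  obtain ⟨x, rfl⟩ := x
  exact (thetaTerm_zero_eq g hg ℓ d τ x).symm

omit [DiscreteTopology L] [IsZLattice ℝ L] in
theorem latticeTheta_slash_T (heven : ∀ x ∈ L, ∃ k : ℤ, ⟪x, x⟫ = 2 * (k : ℝ))
    (ℓ : E₂₄ →L[ℝ] ℂ) (d : ℕ) (k : ℤ) :
    (fun τ : ℍ => latticeTheta L ℓ d τ 0) ∣[k] T = fun τ : ℍ => latticeTheta L ℓ d τ 0 := by
  obtain ⟨g, hg⟩ := exists_nat_norm_sq_eq heven
  ext τ
  have h1 : denom (T : GL (Fin 2) ℝ) τ = 1 := by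
    rw [ModularGroup.denom_apply]
    simp [ModularGroup.T]
  rw [SL_slash_apply, h1, one_zpow, mul_one, modular_T_smul]
  simp only [latticeTheta, thetaTerm_zero_eq g hg]
  simp [Function.Periodic.qParam, mul_add, Complex.exp_add]

theorem latticeTheta_slash_S (hdual : ∀ y, y ∈ L ↔ ∀ x ∈ L, ∃ k : ℤ, ⟪x, y⟫ = (k : ℝ))
    (ℓ : E₂₄ →L[ℝ] ℂ) (hℓ : ∑ i, ℓ (EuclideanSpace.single i 1) ^ 2 = 0) (d : ℕ) :
    (fun τ : ℍ => latticeTheta L ℓ d τ 0) ∣[((12 + d : ℕ) : ℤ)] S =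
      fun τ : ℍ => latticeTheta L ℓ d τ 0 := by
  ext τ
  rw [slash_S_apply, latticeTheta_inversion L ℓ hdual hℓ d τ.im_pos]
  have hπ : (π : ℂ) ≠ 0 := by exact_mod_cast Real.pi_ne_zero
  have hτ := τ.ne_zero
  have h1 : (π : ℂ) / (-(π * I * τ)) = I / τ := by
    field_simp
    simp
  have h2 : ((Fintype.card (Fin 24) : ℂ) / 2) = (12 : ℕ) := by norm_num
  have h3 : I ^ 12 = 1 := by rw [show 12 = 4 * 3 from rfl, pow_mul, I_pow_four, one_pow]
  rw [h1, h2, cpow_natCast, div_pow, h3, zero_div, zpow_neg, zpow_natCast, pow_add, mul_comm]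
  congr 1
  · field_simp
  · simp [inv_neg, neg_div]

theorem latticeTheta_modularForm (heven : ∀ x ∈ L, ∃ k : ℤ, ⟪x, x⟫ = 2 * (k : ℝ))
    (hdual : ∀ y, y ∈ L ↔ ∀ x ∈ L, ∃ k : ℤ, ⟪x, y⟫ = (k : ℝ))
    (ℓ : E₂₄ →L[ℝ] ℂ) (hℓ : ∑ i, ℓ (EuclideanSpace.single i 1) ^ 2 = 0) (d : ℕ) :
    ∃ f : ModularForm 𝒮ℒ ((12 + d : ℕ) : ℤ), ∀ τ : ℍ, f τ = latticeTheta L ℓ d τ 0 := by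
  obtain ⟨g, hg⟩ := exists_nat_norm_sq_eq heven
  have hinv := slash_action_generators_SL2Z (latticeTheta_slash_S hdual ℓ hℓ d)
    (latticeTheta_slash_T heven ℓ d _)
  refine ⟨{ toFun := fun τ : ℍ => latticeTheta L ℓ d τ 0
            slash_action_eq' := ?_
            holo' := ?_
            bdd_at_cusps' := ?_ }, fun τ => rfl⟩
  · rintro A ⟨A, rfl⟩
    exact hinv A
  · rw [UpperHalfPlane.mdifferentiable_iff]
    refine (differentiableOn_latticeTheta L ℓ d).congr fun τ hτ => ?_
    simp [ofComplex_apply_of_im_pos hτ]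
  · intro c hc
    rw [Subgroup.IsArithmetic.isCusp_iff_isCusp_SL2Z] at hc
    rw [OnePoint.isBoundedAt_iff_forall_SL2Z hc]
    intro γ _
    refine (hinv γ).symm ▸ ?_
    exact isBoundedAtImInfty_of_hasSum_qExpansion one_pos (hasSum_latticeTheta g hg ℓ d)

theorem sum_minimalVectors_pow_eq_zero (heven : ∀ x ∈ L, ∃ k : ℤ, ⟪x, x⟫ = 2 * (k : ℝ))
    (hdual : ∀ y, y ∈ L ↔ ∀ x ∈ L, ∃ k : ℤ, ⟪x, y⟫ = (k : ℝ))
    (hmin : ∀ x ∈ L, x ≠ 0 → 4 ≤ ⟪x, x⟫) {M : Finset (EuclideanSpace ℝ (Fin 24))}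
    (hM : ∀ x, x ∈ M ↔ x ∈ L ∧ ⟪x, x⟫ = 4) (ℓ : EuclideanSpace ℝ (Fin 24) →L[ℝ] ℂ)
    (hℓ : ∑ i, ℓ (EuclideanSpace.single i 1) ^ 2 = 0) {d : ℕ} (hd0 : d ≠ 0) (hd : d < 12) :
    ∑ y ∈ M, ℓ y ^ d = 0 := by
  obtain ⟨g, hg⟩ := exists_nat_norm_sq_eq heven
  obtain ⟨f, hf⟩ := latticeTheta_modularForm heven hdual ℓ hℓ d
  have hcoeff := ModularFormClass.qExpansion_coeff_unique (f := f) one_pos one_mem_strictPeriods_SL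
    fun τ => hf τ ▸ hasSum_latticeTheta g hg ℓ d τ
  have hlt (m : ℕ) (hm : m < 2) : ∑' x : {x : L // g x = m}, ℓ x.1 ^ d = 0 := by
    refine (tsum_congr fun x => ?_).trans tsum_zero
    obtain ⟨x, rfl⟩ := x
    by_cases hx : (x : E₂₄) = 0
    · rw [hx, map_zero, zero_pow hd0]
    · have h4 := hmin x x.2 hx
      rw [real_inner_self_eq_norm_sq, hg] at h4
      have : (g x : ℝ) < 2 := by exact_mod_cast hm
      linarith
  have hf0 : f = 0 := by
    refine sturm_bound_levelOne_nat ?_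
    rw [show (12 + d) / 12 = 1 by lia]
    refine lt_of_lt_of_le (b := ((2 : ℕ) : ℕ∞)) (by norm_num) (PowerSeries.nat_le_order _ _ fun m hm => ?_)
    rw [← hcoeff, hlt m hm]
  have h2 : ∑' x : {x : L // g x = 2}, ℓ x.1 ^ d = 0 := by
    rw [hcoeff, hf0]
    simp [UpperHalfPlane.qExpansion_zero]
  let e : {x : L // g x = 2} ≃ M :=
    { toFun := fun x => ⟨x.1, (hM _).2 ⟨x.1.2, by
        rw [real_inner_self_eq_norm_sq, hg, x.2]; norm_num⟩⟩
      invFun := fun y => ⟨⟨y.1, ((hM _).1 y.2).1⟩, by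
        have h1 := ((hM _).1 y.2).2
        rw [real_inner_self_eq_norm_sq] at h1
        have h3 := hg ⟨y.1, ((hM _).1 y.2).1⟩
        rw [h1] at h3
        have : (g ⟨y.1, ((hM _).1 y.2).1⟩ : ℝ) = 2 := by linarith
        exact_mod_cast this⟩
      left_inv := fun x => rfl
      right_inv := fun y => rfl }
  rw [← Finset.tsum_subtype, ← e.tsum_eq]
  exact h2

end LeechTheta

section Moments

variable {M : Finset E₂₄}

theorem exists_orthonormalBasis_apply_eq {u : E₂₄} (hu : ‖u‖ = 1) :
    ∃ (e : OrthonormalBasis (Fin 24) ℝ E₂₄) (i : Fin 24), e i = u := by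
  have h : Orthonormal ℝ (({0} : Set (Fin 24)).domRestrict fun _ => u) := by
    refine ⟨fun _ => hu, fun i j hij => (hij (Subsingleton.elim i j)).elim⟩
  obtain ⟨e, he⟩ := h.exists_orthonormalBasis_extension_of_card_eq (by simp)
  exact ⟨e, 0, he 0 rfl⟩

theorem sum_inner_sq_eq_four (hM : ∀ y ∈ M, ⟪y, y⟫ = 4) (e : OrthonormalBasis (Fin 24) ℝ E₂₄)
    {y : E₂₄} (hy : y ∈ M) : ∑ i, ⟪y, e i⟫ ^ 2 = 4 := by
  rw [← hM y hy, real_inner_self_eq_norm_sq, ← e.sum_sq_inner_left]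

theorem sum_inner_sq_of_unit (hM : ∀ y ∈ M, ⟪y, y⟫ = 4)
    (h2 : ∀ a b : E₂₄, ⟪a, a⟫ = ⟪b, b⟫ → ⟪a, b⟫ = 0 → ∑ y ∈ M, (⟪y, a⟫ ^ 2 - ⟪y, b⟫ ^ 2) = 0)
    {u : E₂₄} (hu : ‖u‖ = 1) : ∑ y ∈ M, ⟪y, u⟫ ^ 2 = M.card / 6 := by
  obtain ⟨e, i, rfl⟩ := exists_orthonormalBasis_apply_eq hu
  have h (j : Fin 24) : ∑ y ∈ M, (⟪y, e i⟫ ^ 2 - ⟪y, e j⟫ ^ 2) = 0 := by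
    by_cases hij : i = j
    · simp [hij]
    · exact h2 _ _ (by simp) (e.orthonormal.2 hij)
  have hsum := Finset.sum_congr (rfl : (Finset.univ : Finset (Fin 24)) = _) fun j _ => h j
  rw [Finset.sum_comm] at hsum
  have hy (y : E₂₄) (hy : y ∈ M) : ∑ j, (⟪y, e i⟫ ^ 2 - ⟪y, e j⟫ ^ 2) = 24 * ⟪y, e i⟫ ^ 2 - 4 := by
    rw [Finset.sum_sub_distrib, sum_inner_sq_eq_four hM e hy]
    simp
  rw [Finset.sum_congr rfl hy, Finset.sum_sub_distrib, ← Finset.mul_sum] at hsum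
  simp only [Finset.sum_const, nsmul_eq_mul, mul_zero] at hsum
  linarith

theorem sum_inner_pow_four_of_unit (hM : ∀ y ∈ M, ⟪y, y⟫ = 4)
    (h2 : ∀ u : E₂₄, ‖u‖ = 1 → ∑ y ∈ M, ⟪y, u⟫ ^ 2 = M.card / 6)
    (h4 : ∀ a b : E₂₄, ⟪a, a⟫ = ⟪b, b⟫ → ⟪a, b⟫ = 0 →
      ∑ y ∈ M, (⟪y, a⟫ ^ 4 - 6 * ⟪y, a⟫ ^ 2 * ⟪y, b⟫ ^ 2 + ⟪y, b⟫ ^ 4) = 0)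
    {u : E₂₄} (hu : ‖u‖ = 1) : ∑ y ∈ M, ⟪y, u⟫ ^ 4 = M.card / 13 := by
  obtain ⟨e, i₀, rfl⟩ := exists_orthonormalBasis_apply_eq hu
  set m : Fin 24 → ℝ := fun i => ∑ y ∈ M, ⟪y, e i⟫ ^ 4 with hm
  have h (i j : Fin 24) :
      ∑ y ∈ M, (⟪y, e i⟫ ^ 4 - 6 * ⟪y, e i⟫ ^ 2 * ⟪y, e j⟫ ^ 2 + ⟪y, e j⟫ ^ 4) =
        if i = j then -4 * m i else 0 := by
    split_ifs with hij
    · rw [hm, Finset.mul_sum, hij]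
      exact Finset.sum_congr rfl fun y _ => by ring
    · exact h4 _ _ (by simp) (e.orthonormal.2 hij)
  have key (i : Fin 24) : 28 * m i + ∑ j, m j = 4 * M.card := by
    have hsum := Finset.sum_congr (rfl : (Finset.univ : Finset (Fin 24)) = _) fun j _ => h i j
    rw [Finset.sum_comm, Finset.sum_ite_eq, if_pos (Finset.mem_univ i)] at hsum
    have hy (y : E₂₄) (hy : y ∈ M) :
        ∑ j, (⟪y, e i⟫ ^ 4 - 6 * ⟪y, e i⟫ ^ 2 * ⟪y, e j⟫ ^ 2 + ⟪y, e j⟫ ^ 4) =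
          24 * ⟪y, e i⟫ ^ 4 - 24 * ⟪y, e i⟫ ^ 2 + ∑ j, ⟪y, e j⟫ ^ 4 := by
      rw [Finset.sum_add_distrib, Finset.sum_sub_distrib, ← Finset.mul_sum,
        sum_inner_sq_eq_four hM e hy]
      simp
      ring
    rw [Finset.sum_congr rfl hy, Finset.sum_add_distrib, Finset.sum_sub_distrib, ← Finset.mul_sum,
      ← Finset.mul_sum, h2 _ (by simp), Finset.sum_comm] at hsum
    simp only [hm] at hsum ⊢
    linarith
  have htot := Finset.sum_congr (rfl : (Finset.univ : Finset (Fin 24)) = _) fun i _ => key i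
  rw [Finset.sum_add_distrib, ← Finset.mul_sum] at htot
  simp only [Finset.sum_const, Finset.card_univ, Fintype.card_fin, nsmul_eq_mul] at htot
  have := key i₀
  push_cast at htot
  change m i₀ = _
  linarith

theorem sum_sum_sextic {ι : Type*} [Fintype ι] (x : ι → ℝ) (a : ℝ) :
    ∑ j, ∑ k, (8 * a ^ 6 - 60 * a ^ 4 * (x j ^ 2 + x k ^ 2) +
      30 * a ^ 2 * (x j ^ 4 + 6 * x j ^ 2 * x k ^ 2 + x k ^ 4) -
      (x j ^ 6 + 15 * x j ^ 4 * x k ^ 2 + 15 * x j ^ 2 * x k ^ 4 + x k ^ 6)) =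
    8 * Fintype.card ι ^ 2 * a ^ 6 - 120 * Fintype.card ι * (∑ j, x j ^ 2) * a ^ 4 +
      (60 * Fintype.card ι * ∑ j, x j ^ 4 + 180 * (∑ j, x j ^ 2) ^ 2) * a ^ 2 -
      2 * Fintype.card ι * ∑ j, x j ^ 6 - 30 * (∑ j, x j ^ 2) * ∑ j, x j ^ 4 := by
  simp only [Finset.sum_add_distrib, Finset.sum_sub_distrib, ← Finset.mul_sum, ← Finset.sum_mul,
    Finset.sum_const, Finset.card_univ, nsmul_eq_mul]
  ring

theorem sum_sum_ite_eq {ι : Type*} [Fintype ι] [DecidableEq ι] (i : ι) (c : ℝ) (D G : ι → ℝ) :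
    ∑ j, ∑ k, ((if j = k then D j else 0) + (if i = j then G k else 0) +
      (if i = k then G j else 0) + (if i = j then if i = k then c else 0 else 0)) =
    ∑ j, D j + 2 * ∑ j, G j + c := by
  have h : ∑ j, ∑ k, (if i = j then G k else 0) = ∑ j, G j := by
    rw [Finset.sum_comm]
    simp
  have h' : ∑ j, ∑ k, (if i = j then if i = k then c else 0 else 0) = c := by
    rw [Finset.sum_comm]
    simp
  simp only [Finset.sum_add_distrib, h, h']
  simp
  ring

theorem sum_inner_pow_six_of_unit (hM : ∀ y ∈ M, ⟪y, y⟫ = 4)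
    (h2 : ∀ u : E₂₄, ‖u‖ = 1 → ∑ y ∈ M, ⟪y, u⟫ ^ 2 = M.card / 6)
    (h4 : ∀ u : E₂₄, ‖u‖ = 1 → ∑ y ∈ M, ⟪y, u⟫ ^ 4 = M.card / 13)
    (h6 : ∀ a b : E₂₄, ⟪a, a⟫ = ⟪b, b⟫ → ⟪a, b⟫ = 0 →
      ∑ y ∈ M, (⟪y, a⟫ ^ 6 - 15 * ⟪y, a⟫ ^ 4 * ⟪y, b⟫ ^ 2 + 15 * ⟪y, a⟫ ^ 2 * ⟪y, b⟫ ^ 4 -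
        ⟪y, b⟫ ^ 6) = 0)
    {u : E₂₄} (hu : ‖u‖ = 1) : ∑ y ∈ M, ⟪y, u⟫ ^ 6 = 5 * M.card / 91 := by
  obtain ⟨e, i₀, rfl⟩ := exists_orthonormalBasis_apply_eq hu
  set m : Fin 24 → ℝ := fun i => ∑ y ∈ M, ⟪y, e i⟫ ^ 6 with hm
  set r : Fin 24 → ℝ := fun i => ∑ y ∈ M, ⟪y, e i⟫ ^ 2 * ∑ j, ⟪y, e j⟫ ^ 4 with hr
  have hU (i j : Fin 24) :
      ∑ y ∈ M, (⟪y, e i⟫ ^ 6 - 15 * ⟪y, e i⟫ ^ 4 * ⟪y, e j⟫ ^ 2 +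
        15 * ⟪y, e i⟫ ^ 2 * ⟪y, e j⟫ ^ 4 - ⟪y, e j⟫ ^ 6) = 0 := by
    by_cases hij : i = j
    · rw [hij]
      exact Finset.sum_eq_zero fun y _ => by ring
    · exact h6 _ _ (by simp) (e.orthonormal.2 hij)
  have hS2 (y : E₂₄) (hy : y ∈ M) := sum_inner_sq_eq_four hM e hy
  have hm4 (i : Fin 24) : ∑ y ∈ M, ⟪y, e i⟫ ^ 4 = M.card / 13 := h4 _ (by simp)
  have hm2 (i : Fin 24) : ∑ y ∈ M, ⟪y, e i⟫ ^ 2 = M.card / 6 := h2 _ (by simp)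
  have hP6 : ∑ y ∈ M, ∑ j, ⟪y, e j⟫ ^ 6 = ∑ j, m j := Finset.sum_comm
  have hP4 : ∑ y ∈ M, ∑ j, ⟪y, e j⟫ ^ 4 = 24 * M.card / 13 := by
    rw [Finset.sum_comm]
    simp only [hm4]
    simp
    ring
  have hquad (c₆ c₄ c₂ : ℝ) (c₀ c₆' : ℝ) (i : Fin 24) :
      ∑ y ∈ M, (c₆ * ⟪y, e i⟫ ^ 6 + c₄ * ⟪y, e i⟫ ^ 4 +
        (c₂ + c₀ * ∑ j, ⟪y, e j⟫ ^ 4) * ⟪y, e i⟫ ^ 2 + c₆' * ∑ j, ⟪y, e j⟫ ^ 6) =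
      c₆ * m i + c₄ * (M.card / 13) + c₂ * (M.card / 6) + c₀ * r i + c₆' * ∑ j, m j := by
    rw [← hP6, ← hm2 i, ← hm4 i, hm, hr]
    simp only [Finset.mul_sum, ← Finset.sum_add_distrib]
    refine Finset.sum_congr rfl fun y _ => ?_
    simp only [← Finset.mul_sum]
    ring
  have hE1 (i : Fin 24) : 24 * m i - 60 * (M.card / 13) + 15 * r i - ∑ j, m j = 0 := by
    have hsum := Finset.sum_congr (rfl : (Finset.univ : Finset (Fin 24)) = _) fun j _ => hU i j
    rw [Finset.sum_comm, Finset.sum_const_zero] at hsum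
    have := hquad 24 (-60) 0 15 (-1) i
    rw [← hsum.symm.trans (Finset.sum_congr rfl fun y hy => ?_)] at this
    · linarith
    · have := hS2 y hy
      rw [Finset.sum_sub_distrib, Finset.sum_add_distrib, Finset.sum_sub_distrib, ← Finset.mul_sum,
        ← Finset.mul_sum, this]
      simp
      ring
  have hE2 (i : Fin 24) : 5712 * m i - 11880 * (M.card / 13) + 1170 * r i + 480 * M.card -
      14 * ∑ j, m j - 2880 * M.card / 13 = 0 := by
    have hT (j k : Fin 24) :
        ∑ y ∈ M, (8 * ⟪y, e i⟫ ^ 6 - 60 * ⟪y, e i⟫ ^ 4 * (⟪y, e j⟫ ^ 2 + ⟪y, e k⟫ ^ 2) +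
          30 * ⟪y, e i⟫ ^ 2 * (⟪y, e j⟫ ^ 4 + 6 * ⟪y, e j⟫ ^ 2 * ⟪y, e k⟫ ^ 2 + ⟪y, e k⟫ ^ 4) -
          (⟪y, e j⟫ ^ 6 + 15 * ⟪y, e j⟫ ^ 4 * ⟪y, e k⟫ ^ 2 + 15 * ⟪y, e j⟫ ^ 2 * ⟪y, e k⟫ ^ 4 +
            ⟪y, e k⟫ ^ 6)) =
        (if j = k then ∑ y ∈ M, (8 * ⟪y, e i⟫ ^ 6 - 120 * ⟪y, e i⟫ ^ 4 * ⟪y, e j⟫ ^ 2 +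
          240 * ⟪y, e i⟫ ^ 2 * ⟪y, e j⟫ ^ 4 - 32 * ⟪y, e j⟫ ^ 6) else 0) +
        (if i = j then ∑ y ∈ M, (-23 * ⟪y, e i⟫ ^ 6 + 105 * ⟪y, e i⟫ ^ 4 * ⟪y, e k⟫ ^ 2 +
          15 * ⟪y, e i⟫ ^ 2 * ⟪y, e k⟫ ^ 4 - ⟪y, e k⟫ ^ 6) else 0) +
        (if i = k then ∑ y ∈ M, (-23 * ⟪y, e i⟫ ^ 6 + 105 * ⟪y, e i⟫ ^ 4 * ⟪y, e j⟫ ^ 2 +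
          15 * ⟪y, e i⟫ ^ 2 * ⟪y, e j⟫ ^ 4 - ⟪y, e j⟫ ^ 6) else 0) +
        (if i = j then if i = k then -192 * m i else 0 else 0) := by
      by_cases hjk : j = k
      · subst hjk
        by_cases hij : i = j
        · subst hij
          simp only [if_true, hm, Finset.mul_sum, ← Finset.sum_add_distrib]
          exact Finset.sum_congr rfl fun y _ => by ring
        · simp only [if_true, if_neg hij, add_zero]
          exact Finset.sum_congr rfl fun y _ => by ring
      · by_cases hij : i = j
        · subst hij
          simp only [if_true, if_neg hjk, add_zero, zero_add]
          exact Finset.sum_congr rfl fun y _ => by ring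
        · by_cases hik : i = k
          · subst hik
            simp only [if_true, if_neg hjk, if_neg hij, add_zero, zero_add]
            exact Finset.sum_congr rfl fun y _ => by ring
          · simp only [if_neg hij, if_neg hik, if_neg hjk, add_zero]
            have hoij := e.orthonormal.2 hij
            have hoik := e.orthonormal.2 hik
            have hojk : ⟪e j, e k⟫ = 0 := e.orthonormal.2 hjk
            have hself (l : Fin 24) : ⟪e l, e l⟫ = 1 := by
              rw [real_inner_self_eq_norm_sq, e.orthonormal.1 l, one_pow]
            have hs : (√2 : ℝ) * √2 = 2 := Real.mul_self_sqrt (by norm_num)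
            have hscale : ⟪(√2 : ℝ) • e i, (√2 : ℝ) • e i⟫ = 2 := by
              rw [real_inner_smul_left, real_inner_smul_right, hself, mul_one, hs]
            have hplus := h6 ((√2 : ℝ) • e i) (e j + e k)
              (by rw [hscale, real_inner_add_add_self, hself, hself, hojk]; norm_num)
              (by simp [inner_add_right, real_inner_smul_left, hoij, hoik])
            have hminus := h6 ((√2 : ℝ) • e i) (e j - e k)
              (by rw [hscale, real_inner_sub_sub_self, hself, hself, hojk]; norm_num)
              (by simp [inner_sub_right, real_inner_smul_left, hoij, hoik])
            have h := congrArg₂ (fun s t : ℝ => (s + t) / 2) hplus hminus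
            simp only [add_zero, zero_div] at h
            rw [← h, ← Finset.sum_add_distrib, Finset.sum_div]
            refine Finset.sum_congr rfl fun y _ => ?_
            have hs2 : (√2 : ℝ) ^ 2 = 2 := Real.sq_sqrt (by norm_num)
            have hs4 : (√2 : ℝ) ^ 4 = 4 := by linear_combination (√2 ^ 2 + 2) * hs2
            have hs6 : (√2 : ℝ) ^ 6 = 8 := by linear_combination √2 ^ 4 * hs2 + 2 * hs4
            simp only [inner_add_right, inner_sub_right, real_inner_smul_right, mul_pow, hs2, hs4,
              hs6]
            ring
    have hsum := Finset.sum_congr (rfl : (Finset.univ : Finset (Fin 24)) = _) fun j _ =>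
      Finset.sum_congr (rfl : (Finset.univ : Finset (Fin 24)) = _) fun k _ => hT j k
    rw [sum_sum_ite_eq, Finset.sum_congr rfl fun j _ => Finset.sum_comm, Finset.sum_comm,
      Finset.sum_congr rfl fun y _ => sum_sum_sextic (fun j => ⟪y, e j⟫) ⟪y, e i⟫] at hsum
    have hL := hquad 4608 (-11520) 2880 1440 (-48) i
    have hLP := congrArg₂ (fun s t : ℝ => s + -120 * t) hL hP4
    simp only [Finset.mul_sum M, ← Finset.sum_add_distrib] at hLP
    have hD : ∑ j, ∑ y ∈ M, (8 * ⟪y, e i⟫ ^ 6 - 120 * ⟪y, e i⟫ ^ 4 * ⟪y, e j⟫ ^ 2 +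
        240 * ⟪y, e i⟫ ^ 2 * ⟪y, e j⟫ ^ 4 - 32 * ⟪y, e j⟫ ^ 6) =
          192 * m i + -480 * (M.card / 13) + 0 * (M.card / 6) + 240 * r i + -32 * ∑ j, m j := by
      rw [Finset.sum_comm]
      refine (Finset.sum_congr rfl fun y hy => ?_).trans (hquad 192 (-480) 0 240 (-32) i)
      simp only [Finset.sum_add_distrib, Finset.sum_sub_distrib, ← Finset.mul_sum, hS2 y hy]
      simp
      ring
    have hG : ∑ j, ∑ y ∈ M, (-23 * ⟪y, e i⟫ ^ 6 + 105 * ⟪y, e i⟫ ^ 4 * ⟪y, e j⟫ ^ 2 +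
        15 * ⟪y, e i⟫ ^ 2 * ⟪y, e j⟫ ^ 4 - ⟪y, e j⟫ ^ 6) =
          -552 * m i + 420 * (M.card / 13) + 0 * (M.card / 6) + 15 * r i + -1 * ∑ j, m j := by
      rw [Finset.sum_comm]
      refine (Finset.sum_congr rfl fun y hy => ?_).trans (hquad (-552) 420 0 15 (-1) i)
      simp only [Finset.sum_add_distrib, Finset.sum_sub_distrib, ← Finset.mul_sum, hS2 y hy]
      simp
      ring
    rw [hD, hG] at hsum
    have := hsum.symm.trans ((Finset.sum_congr rfl fun y hy => ?_).trans hLP)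
    · linarith
    · rw [hS2 y hy, Fintype.card_fin]
      push_cast
      ring
  have hlin (i : Fin 24) : 3840 * m i + 64 * ∑ j, m j = 3840 * M.card / 13 := by
    linarith [hE1 i, hE2 i]
  have htot := Finset.sum_congr (rfl : (Finset.univ : Finset (Fin 24)) = _) fun i _ => hlin i
  rw [Finset.sum_add_distrib, ← Finset.mul_sum] at htot
  simp only [Finset.sum_const, Finset.card_univ, Fintype.card_fin, nsmul_eq_mul] at htot
  push_cast at htot
  have := hlin i₀
  change m i₀ = _
  linarith

end Moments

section Designs

variable {L : Submodule ℤ E₂₄} {M : Finset E₂₄}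

theorem sum_minimalVectors_inner_pow_eq_zero [DiscreteTopology L] [IsZLattice ℝ L]
    (heven : ∀ x ∈ L, ∃ k : ℤ, ⟪x, x⟫ = 2 * (k : ℝ))
    (hdual : ∀ y, y ∈ L ↔ ∀ x ∈ L, ∃ k : ℤ, ⟪x, y⟫ = (k : ℝ))
    (hmin : ∀ x ∈ L, x ≠ 0 → 4 ≤ ⟪x, x⟫)
    (hM : ∀ x, x ∈ M ↔ x ∈ L ∧ ⟪x, x⟫ = 4)
    {a b : E₂₄} (hab : ⟪a, a⟫ = ⟪b, b⟫) (h0 : ⟪a, b⟫ = 0) {d : ℕ} (hd0 : d ≠ 0) (hd : d < 12) :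
    ∑ y ∈ M, ((⟪y, a⟫ : ℂ) + (⟪y, b⟫ : ℂ) * Complex.I) ^ d = 0 := by
  let ℓ : E₂₄ →L[ℝ] ℂ :=
    Complex.ofRealCLM.comp (innerSL ℝ a) + Complex.I • Complex.ofRealCLM.comp (innerSL ℝ b)
  have hℓ (y : E₂₄) : ℓ y = (⟪y, a⟫ : ℂ) + (⟪y, b⟫ : ℂ) * Complex.I := by
    simp [ℓ, real_inner_comm, mul_comm]
  have hsum : ∑ i, ℓ (EuclideanSpace.single i 1) ^ 2 = 0 := by
    have h1 : ∑ i, a i ^ 2 = ∑ i, b i ^ 2 := by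
      rw [← EuclideanSpace.real_norm_sq_eq, ← EuclideanSpace.real_norm_sq_eq,
        ← real_inner_self_eq_norm_sq, ← real_inner_self_eq_norm_sq, hab]
    have h2 : ∑ i, a i * b i = 0 := by
      simpa [PiLp.inner_apply, mul_comm] using h0
    have h (i : Fin 24) : ℓ (EuclideanSpace.single i 1) ^ 2 =
        ((a i ^ 2 - b i ^ 2 : ℝ) : ℂ) + 2 * ((a i * b i : ℝ) : ℂ) * Complex.I := by
      rw [hℓ, EuclideanSpace.inner_single_left, EuclideanSpace.inner_single_left]
      simp only [map_one, one_mul, add_sq, mul_pow, Complex.I_sq]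
      push_cast
      ring
    simp only [h, Finset.sum_add_distrib, ← Finset.sum_mul, ← Finset.mul_sum, ← Complex.ofReal_sum,
      Finset.sum_sub_distrib, h1, h2]
    simp
  rw [← sum_minimalVectors_pow_eq_zero heven hdual hmin hM ℓ hsum hd0 hd]
  exact Finset.sum_congr rfl fun y _ => by rw [hℓ]

theorem sum_inner_pow_of_unit {d : ℕ} {c : ℝ}
    (h : ∀ u : E₂₄, ‖u‖ = 1 → ∑ y ∈ M, ⟪y, u⟫ ^ (2 * d) = c) (hd : d ≠ 0) (u : E₂₄) :
    ∑ y ∈ M, ⟪y, u⟫ ^ (2 * d) = c * ⟪u, u⟫ ^ d := by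
  rcases eq_or_ne u 0 with rfl | hu
  · simp [hd]
  have hu' : ‖u‖ ≠ 0 := norm_ne_zero_iff.2 hu
  rw [← h (‖u‖⁻¹ • u) (by simp [norm_smul, hu']), Finset.sum_mul, real_inner_self_eq_norm_sq]
  refine Finset.sum_congr rfl fun y _ => ?_
  rw [real_inner_smul_right, mul_pow, ← pow_mul, mul_right_comm, ← mul_pow, inv_mul_cancel₀ hu',
    one_pow, one_mul]

theorem sum_minimalVectors_inner_pow [DiscreteTopology L] [IsZLattice ℝ L]
    (heven : ∀ x ∈ L, ∃ k : ℤ, ⟪x, x⟫ = 2 * (k : ℝ))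
    (hdual : ∀ y, y ∈ L ↔ ∀ x ∈ L, ∃ k : ℤ, ⟪x, y⟫ = (k : ℝ))
    (hmin : ∀ x ∈ L, x ≠ 0 → 4 ≤ ⟪x, x⟫)
    (hM : ∀ x, x ∈ M ↔ x ∈ L ∧ ⟪x, x⟫ = 4) (u : E₂₄) :
    ∑ y ∈ M, ⟪y, u⟫ ^ 2 = M.card / 6 * ⟪u, u⟫ ∧
    ∑ y ∈ M, ⟪y, u⟫ ^ 4 = M.card / 13 * ⟪u, u⟫ ^ 2 ∧
    ∑ y ∈ M, ⟪y, u⟫ ^ 6 = 5 * M.card / 91 * ⟪u, u⟫ ^ 3 := by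
  have hM4 : ∀ y ∈ M, ⟪y, y⟫ = 4 := fun y hy => ((hM y).1 hy).2
  have hre {a b : E₂₄} (hab : ⟪a, a⟫ = ⟪b, b⟫) (h0 : ⟪a, b⟫ = 0) {d : ℕ} (hd0 : d ≠ 0)
      (hd : d < 12) : ∑ y ∈ M, (((⟪y, a⟫ : ℂ) + (⟪y, b⟫ : ℂ) * Complex.I) ^ d).re = 0 := by
    rw [← Complex.re_sum, sum_minimalVectors_inner_pow_eq_zero heven hdual hmin hM hab h0 hd0 hd,
      Complex.zero_re]
  have h2 (u : E₂₄) (hu : ‖u‖ = 1) : ∑ y ∈ M, ⟪y, u⟫ ^ 2 = M.card / 6 := by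
    refine sum_inner_sq_of_unit hM4 (fun a b hab h0 => ?_) hu
    rw [← hre hab h0 (d := 2) (by norm_num) (by norm_num)]
    refine Finset.sum_congr rfl fun y _ => ?_
    simp [pow_succ]
  have h4 (u : E₂₄) (hu : ‖u‖ = 1) : ∑ y ∈ M, ⟪y, u⟫ ^ 4 = M.card / 13 := by
    refine sum_inner_pow_four_of_unit hM4 h2 (fun a b hab h0 => ?_) hu
    rw [← hre hab h0 (d := 4) (by norm_num) (by norm_num)]
    refine Finset.sum_congr rfl fun y _ => ?_
    simp [pow_succ]
    ring
  have h6 (u : E₂₄) (hu : ‖u‖ = 1) : ∑ y ∈ M, ⟪y, u⟫ ^ 6 = 5 * M.card / 91 := by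
    refine sum_inner_pow_six_of_unit hM4 h2 h4 (fun a b hab h0 => ?_) hu
    rw [← hre hab h0 (d := 6) (by norm_num) (by norm_num)]
    refine Finset.sum_congr rfl fun y _ => ?_
    simp [pow_succ]
    ring
  refine ⟨?_, sum_inner_pow_of_unit (d := 2) h4 two_ne_zero u,
    sum_inner_pow_of_unit (d := 3) h6 three_ne_zero u⟩
  simpa using sum_inner_pow_of_unit (d := 1) h2 one_ne_zero u

end Designs

section Counting

variable {L : Submodule ℤ E₂₄} {M : Finset E₂₄}

theorem finite_setOf_mem_inner_self_eq {V : Type*} [NormedAddCommGroup V] [InnerProductSpace ℝ V]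
    [FiniteDimensional ℝ V] (L : Submodule ℤ V) [DiscreteTopology L] (c : ℝ) :
    {x : V | x ∈ L ∧ ⟪x, x⟫ = c}.Finite := by
  have hclosed : IsClosed (L : Set V) :=
    inferInstanceAs (IsClosed (L.toAddSubgroup : Set V))
  refine (Metric.finite_isBounded_inter_isClosed
    ⟨inferInstanceAs (DiscreteTopology L)⟩ (Metric.isBounded_closedBall (x := (0 : V)) (r := √c))
    hclosed).subset ?_
  rintro x ⟨hx, rfl⟩
  refine ⟨?_, hx⟩
  rw [mem_closedBall_zero_iff, norm_eq_sqrt_real_inner]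

theorem two_mul_inner_le_of_ne (hmin : ∀ x ∈ L, x ≠ 0 → 4 ≤ ⟪x, x⟫) {x y : E₂₄} (hx : x ∈ L)
    (hy : y ∈ L) (hxy : x ≠ y) : 2 * ⟪x, y⟫ ≤ ⟪x, x⟫ + ⟪y, y⟫ - 4 := by
  have := hmin (x - y) (L.sub_mem hx hy) (sub_ne_zero.2 hxy)
  rw [real_inner_sub_sub_self] at this
  linarith

variable {A B : E₂₄}

theorem sum_minimalVectors_moments [DiscreteTopology L] [IsZLattice ℝ L]
    (heven : ∀ x ∈ L, ∃ k : ℤ, ⟪x, x⟫ = 2 * (k : ℝ))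
    (hdual : ∀ y, y ∈ L ↔ ∀ x ∈ L, ∃ k : ℤ, ⟪x, y⟫ = (k : ℝ))
    (hmin : ∀ x ∈ L, x ≠ 0 → 4 ≤ ⟪x, x⟫)
    (hM : ∀ x, x ∈ M ↔ x ∈ L ∧ ⟪x, x⟫ = 4)
    (hAA : ⟪A, A⟫ = 4) (hBB : ⟪B, B⟫ = 4) (hAB : ⟪A, B⟫ = -1) :
    ∑ y ∈ M, ⟪y, A⟫ ^ 2 * (⟪y, A⟫ ^ 2 - 1) * (⟪y, A⟫ ^ 2 - 4) = 8 / 273 * (M.card : ℝ) ∧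
    ∑ y ∈ M, ⟪y, A⟫ * ⟪y, B⟫ * (⟪y, B⟫ ^ 2 - 1) *
      (2 * ⟪y, A⟫ ^ 2 + 3 * ⟪y, A⟫ * ⟪y, B⟫ + 4) = 8 / 39 * (M.card : ℝ) := by
  have hD := sum_minimalVectors_inner_pow heven hdual hmin hM
  have hQ (s t : ℝ) : ⟪s • A + t • B, s • A + t • B⟫ = 4 * s ^ 2 - 2 * s * t + 4 * t ^ 2 := by
    rw [real_inner_add_add_self]
    simp only [real_inner_smul_left, real_inner_smul_right, hAA, hBB, hAB]
    ring
  have hy (s t : ℝ) (y : E₂₄) : ⟪y, s • A + t • B⟫ = s * ⟪y, A⟫ + t * ⟪y, B⟫ := by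
    rw [inner_add_right, real_inner_smul_right, real_inner_smul_right]
  let m (i j : ℕ) : ℝ := ∑ y ∈ M, ⟪y, A⟫ ^ i * ⟪y, B⟫ ^ j
  have h2 (s t : ℝ) : s ^ 2 * m 2 0 + 2 * s * t * m 1 1 + t ^ 2 * m 0 2 =
      M.card / 6 * (4 * s ^ 2 - 2 * s * t + 4 * t ^ 2) := by
    rw [← hQ, ← (hD _).1]
    simp only [m, Finset.mul_sum, ← Finset.sum_add_distrib, hy]
    exact Finset.sum_congr rfl fun y _ => by ring
  have h4 (s t : ℝ) : s ^ 4 * m 4 0 + 4 * s ^ 3 * t * m 3 1 + 6 * s ^ 2 * t ^ 2 * m 2 2 +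
      4 * s * t ^ 3 * m 1 3 + t ^ 4 * m 0 4 =
      M.card / 13 * (4 * s ^ 2 - 2 * s * t + 4 * t ^ 2) ^ 2 := by
    rw [← hQ, ← (hD _).2.1]
    simp only [m, Finset.mul_sum, ← Finset.sum_add_distrib, hy]
    exact Finset.sum_congr rfl fun y _ => by ring
  have h6 (s t : ℝ) : s ^ 6 * m 6 0 + 6 * s ^ 5 * t * m 5 1 + 15 * s ^ 4 * t ^ 2 * m 4 2 +
      20 * s ^ 3 * t ^ 3 * m 3 3 + 15 * s ^ 2 * t ^ 4 * m 2 4 + 6 * s * t ^ 5 * m 1 5 +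
      t ^ 6 * m 0 6 = 5 * M.card / 91 * (4 * s ^ 2 - 2 * s * t + 4 * t ^ 2) ^ 3 := by
    rw [← hQ, ← (hD _).2.2]
    simp only [m, Finset.mul_sum, ← Finset.sum_add_distrib, hy]
    exact Finset.sum_congr rfl fun y _ => by ring
  constructor
  · have h : ∑ y ∈ M, ⟪y, A⟫ ^ 2 * (⟪y, A⟫ ^ 2 - 1) * (⟪y, A⟫ ^ 2 - 4) =
        m 6 0 - 5 * m 4 0 + 4 * m 2 0 := by
      simp only [m, Finset.mul_sum, ← Finset.sum_add_distrib, ← Finset.sum_sub_distrib]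
      exact Finset.sum_congr rfl fun y _ => by ring
    linarith [h2 1 0, h4 1 0, h6 1 0]
  · have h : ∑ y ∈ M, ⟪y, A⟫ * ⟪y, B⟫ * (⟪y, B⟫ ^ 2 - 1) *
        (2 * ⟪y, A⟫ ^ 2 + 3 * ⟪y, A⟫ * ⟪y, B⟫ + 4) =
        2 * m 3 3 + 3 * m 2 4 + 4 * m 1 3 - 2 * m 3 1 - 3 * m 2 2 - 4 * m 1 1 := by
      simp only [m, Finset.mul_sum, ← Finset.sum_add_distrib, ← Finset.sum_sub_distrib]
      exact Finset.sum_congr rfl fun y _ => by ring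
    linarith [h2 1 0, h2 0 1, h2 1 1, h4 1 0, h4 0 1, h4 1 1, h4 1 (-1), h4 1 2, h6 1 0, h6 0 1,
      h6 1 1, h6 1 (-1), h6 1 2, h6 1 (-2), h6 2 1]

theorem inner_mem_of_minimal
    (hdual : ∀ y, y ∈ L ↔ ∀ x ∈ L, ∃ k : ℤ, ⟪x, y⟫ = (k : ℝ))
    (hmin : ∀ x ∈ L, x ≠ 0 → 4 ≤ ⟪x, x⟫) {y : E₂₄} (hy : y ∈ L) (hyy : ⟪y, y⟫ = 4)
    (hA : A ∈ L) (hAA : ⟪A, A⟫ = 4) (h : y ≠ A) (h' : y ≠ -A) :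
    ∃ k : ℤ, ⟪y, A⟫ = k ∧ -2 ≤ k ∧ k ≤ 2 := by
  obtain ⟨k, hk⟩ := (hdual A).1 hA y hy
  have h1 := two_mul_inner_le_of_ne hmin hy hA h
  have h2 := two_mul_inner_le_of_ne hmin hy (L.neg_mem hA) h'
  rw [inner_neg_right, inner_neg_neg] at h2
  rw [hyy, hAA, hk] at h1 h2
  refine ⟨k, hk, ?_, ?_⟩
  · have : (-2 : ℝ) ≤ k := by linarith
    exact_mod_cast this
  · have : (k : ℝ) ≤ 2 := by linarith
    exact_mod_cast this

theorem card_minimalVectors [DiscreteTopology L] [IsZLattice ℝ L]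
    (heven : ∀ x ∈ L, ∃ k : ℤ, ⟪x, x⟫ = 2 * (k : ℝ))
    (hdual : ∀ y, y ∈ L ↔ ∀ x ∈ L, ∃ k : ℤ, ⟪x, y⟫ = (k : ℝ))
    (hmin : ∀ x ∈ L, x ≠ 0 → 4 ≤ ⟪x, x⟫)
    (hM : ∀ x, x ∈ M ↔ x ∈ L ∧ ⟪x, x⟫ = 4)
    (hA : A ∈ L) (hAA : ⟪A, A⟫ = 4) (hBB : ⟪B, B⟫ = 4) (hAB : ⟪A, B⟫ = -1) :
    M.card = 196560 := by
  have hsum := (sum_minimalVectors_moments heven hdual hmin hM hAA hBB hAB).1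
  have hA0 : A ≠ -A := fun h => by
    have := congrArg (fun x => ⟪x, A⟫) h
    simp only [inner_neg_left, hAA] at this
    norm_num at this
  have hval (y : E₂₄) (hy : y ∈ M) : ⟪y, A⟫ ^ 2 * (⟪y, A⟫ ^ 2 - 1) * (⟪y, A⟫ ^ 2 - 4) =
      (if y = A then 2880 else 0) + (if y = -A then 2880 else 0) := by
    by_cases h1 : y = A
    · rw [if_pos h1, if_neg (h1 ▸ hA0), h1, hAA]
      norm_num
    by_cases h2 : y = -A
    · rw [if_neg h1, if_pos h2, h2, inner_neg_left, hAA]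
      norm_num
    obtain ⟨hyL, hyy⟩ := (hM y).1 hy
    obtain ⟨k, hk, hk1, hk2⟩ := inner_mem_of_minimal hdual hmin hyL hyy hA hAA h1 h2
    rw [if_neg h1, if_neg h2, hk]
    interval_cases k <;> norm_num
  rw [Finset.sum_congr rfl hval, Finset.sum_add_distrib, Finset.sum_ite_eq', Finset.sum_ite_eq',
    if_pos ((hM A).2 ⟨hA, hAA⟩), if_pos ((hM (-A)).2 ⟨L.neg_mem hA, by simpa using hAA⟩)] at hsum
  have : (M.card : ℝ) = 196560 := by linarith
  exact_mod_cast this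

theorem minimalVectors_weight_eq
    (hdual : ∀ y, y ∈ L ↔ ∀ x ∈ L, ∃ k : ℤ, ⟪x, y⟫ = (k : ℝ))
    (hmin : ∀ x ∈ L, x ≠ 0 → 4 ≤ ⟪x, x⟫)
    (hA : A ∈ L) (hB : B ∈ L) (hAA : ⟪A, A⟫ = 4) (hBB : ⟪B, B⟫ = 4) (hAB : ⟪A, B⟫ = -1)
    {y : E₂₄} (hy : y ∈ L) (hyy : ⟪y, y⟫ = 4) :
    ⟪y, A⟫ * ⟪y, B⟫ * (⟪y, B⟫ ^ 2 - 1) * (2 * ⟪y, A⟫ ^ 2 + 3 * ⟪y, A⟫ * ⟪y, B⟫ + 4) =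
      (if ⟪y, A⟫ = -1 ∧ ⟪y, B⟫ = -2 then 72 else 0) +
      (if ⟪-y, A⟫ = -1 ∧ ⟪-y, B⟫ = -2 then 72 else 0) +
      (if y = B then 360 else 0) + (if y = -B then 360 else 0) := by
  have hBA : ⟪B, A⟫ = -1 := by rw [real_inner_comm, hAB]
  have hB0 : B ≠ -B := fun h => by
    have := congrArg (fun x => ⟪x, B⟫) h
    simp only [inner_neg_left, hBB] at this
    norm_num at this
  by_cases hyB : y = B
  · subst hyB
    rw [if_neg hB0]
    simp only [inner_neg_left, hBB, hBA]
    norm_num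
  by_cases hyB' : y = -B
  · rw [if_neg hyB, if_pos hyB']
    subst hyB'
    simp only [inner_neg_left, hBB, hBA, neg_neg]
    norm_num
  rw [if_neg hyB, if_neg hyB']
  by_cases hyA : y = A
  · subst hyA
    simp only [inner_neg_left, hAA, hAB]
    norm_num
  by_cases hyA' : y = -A
  · subst hyA'
    simp only [inner_neg_left, hAA, hAB, neg_neg]
    norm_num
  obtain ⟨k, hk, hk1, hk2⟩ := inner_mem_of_minimal hdual hmin hy hyy hA hAA hyA hyA'
  obtain ⟨l, hl, hl1, hl2⟩ := inner_mem_of_minimal hdual hmin hy hyy hB hBB hyB hyB'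
  have hABB : ⟪A + B, A + B⟫ = 6 := by
    rw [real_inner_add_add_self, hAA, hBB, hAB]
    norm_num
  have h1 := two_mul_inner_le_of_ne hmin hy (L.add_mem hA hB) fun h => by
    rw [h, hABB] at hyy
    norm_num at hyy
  have h2 := two_mul_inner_le_of_ne hmin hy (L.neg_mem (L.add_mem hA hB)) fun h => by
    rw [h, inner_neg_neg, hABB] at hyy
    norm_num at hyy
  rw [inner_neg_right, inner_neg_neg] at h2
  rw [hABB, hyy, inner_add_right, hk, hl] at h1 h2
  have h3 : k + l ≤ 3 := by
    have : (k + l : ℝ) ≤ 3 := by linarith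
    exact_mod_cast this
  have h4 : -3 ≤ k + l := by
    have : (-3 : ℝ) ≤ k + l := by linarith
    exact_mod_cast this
  simp only [inner_neg_left, hk, hl]
  clear h1 h2 hk hl
  interval_cases k <;> interval_cases l <;> first | omega | norm_num

theorem card_minimalVectors_filter [DiscreteTopology L] [IsZLattice ℝ L]
    (heven : ∀ x ∈ L, ∃ k : ℤ, ⟪x, x⟫ = 2 * (k : ℝ))
    (hdual : ∀ y, y ∈ L ↔ ∀ x ∈ L, ∃ k : ℤ, ⟪x, y⟫ = (k : ℝ))
    (hmin : ∀ x ∈ L, x ≠ 0 → 4 ≤ ⟪x, x⟫)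
    (hM : ∀ x, x ∈ M ↔ x ∈ L ∧ ⟪x, x⟫ = 4)
    (hA : A ∈ L) (hB : B ∈ L) (hAA : ⟪A, A⟫ = 4) (hBB : ⟪B, B⟫ = 4) (hAB : ⟪A, B⟫ = -1) :
    (M.filter fun y => ⟪y, A⟫ = -1 ∧ ⟪y, B⟫ = -2).card = 275 := by
  have hsum := (sum_minimalVectors_moments heven hdual hmin hM hAA hBB hAB).2
  have hneg (y : E₂₄) (hy : y ∈ M) : -y ∈ M := by
    rw [hM, inner_neg_neg]
    exact ⟨L.neg_mem ((hM y).1 hy).1, ((hM y).1 hy).2⟩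
  have hsymm : ∑ y ∈ M, (if ⟪-y, A⟫ = -1 ∧ ⟪-y, B⟫ = -2 then (72 : ℝ) else 0) =
      ∑ y ∈ M, (if ⟪y, A⟫ = -1 ∧ ⟪y, B⟫ = -2 then (72 : ℝ) else 0) :=
    Finset.sum_bij' (fun y _ => -y) (fun y _ => -y) hneg hneg (by simp) (by simp) (by simp)
  rw [Finset.sum_congr rfl fun y hy => minimalVectors_weight_eq hdual hmin hA hB hAA hBB hAB
      ((hM y).1 hy).1 ((hM y).1 hy).2, Finset.sum_add_distrib, Finset.sum_add_distrib,
    Finset.sum_add_distrib, hsymm, Finset.sum_ite_eq', Finset.sum_ite_eq',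
    if_pos ((hM B).2 ⟨hB, hBB⟩), if_pos (hneg B ((hM B).2 ⟨hB, hBB⟩)), ← Finset.sum_filter,
    Finset.sum_const, nsmul_eq_mul,
    card_minimalVectors heven hdual hmin hM hA hAA hBB hAB] at hsum
  push_cast at hsum
  have : ((M.filter fun y => ⟪y, A⟫ = -1 ∧ ⟪y, B⟫ = -2).card : ℝ) = 275 := by linarith
  exact_mod_cast this

end Counting

/-- in the Leech lattice, for norm-4 vectors `A`, `B` with `⟨A,B⟩ = -1`, the set
`X₁⁰ = {x ∈ Λ : ⟨x,x⟩ = 6, ⟨x,A⟩ = 3, ⟨x,B⟩ = -3}` has exactly 275 elements. -/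
theorem statement11
    (L : Submodule ℤ (EuclideanSpace ℝ (Fin 24)))
    [DiscreteTopology L] [IsZLattice ℝ L]
    (heven : ∀ x ∈ L, ∃ k : ℤ, ⟪x, x⟫ = 2 * (k : ℝ))
    (hdual : ∀ y : EuclideanSpace ℝ (Fin 24), y ∈ L ↔ ∀ x ∈ L, ∃ k : ℤ, ⟪x, y⟫ = (k : ℝ))
    (hmin : ∀ x ∈ L, x ≠ 0 → 4 ≤ ⟪x, x⟫)
    (A B : EuclideanSpace ℝ (Fin 24)) (hA : A ∈ L) (hB : B ∈ L)
    (hAA : ⟪A, A⟫ = 4) (hBB : ⟪B, B⟫ = 4) (hAB : ⟪A, B⟫ = -1)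
    :
    {x : EuclideanSpace ℝ (Fin 24) |
        x ∈ L ∧ ⟪x, x⟫ = 6 ∧ ⟪x, A⟫ = 3 ∧ ⟪x, B⟫ = -3}.ncard = 275 := by
  have hfin := finite_setOf_mem_inner_self_eq L 4
  have hM (x : EuclideanSpace ℝ (Fin 24)) : x ∈ hfin.toFinset ↔ x ∈ L ∧ ⟪x, x⟫ = 4 :=
    hfin.mem_toFinset
  rw [← card_minimalVectors_filter heven hdual hmin hM hA hB hAA hBB hAB, ← Set.ncard_coe_finset]
  refine Eq.trans ?_ (Set.ncard_image_of_injective _ (add_left_injective A))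
  congr 1
  ext x
  simp only [Set.mem_ofPred_eq, Set.mem_image, Finset.mem_coe, Finset.mem_filter, hM]
  constructor
  · rintro ⟨hx, hxx, hxA, hxB⟩
    refine ⟨x - A, ⟨⟨L.sub_mem hx hA, ?_⟩, ?_, ?_⟩, sub_add_cancel x A⟩
    · rw [real_inner_sub_sub_self, hxx, hxA, hAA]
      norm_num
    · rw [inner_sub_left, hxA, hAA]
      norm_num
    · rw [inner_sub_left, hxB, hAB]
      norm_num
  · rintro ⟨y, ⟨⟨hy, hyy⟩, hyA, hyB⟩, rfl⟩
    refine ⟨L.add_mem hy hA, ?_, ?_, ?_⟩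
    · rw [real_inner_add_add_self, hyy, hyA, hAA]
      norm_num
    · rw [inner_add_left, hyA, hAA]
      norm_num
    · rw [inner_add_left, hyB, hAB]
      norm_num
end
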